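/- There exists ε₀ > 0 such that for every 0 < ε < ε₀ the set of global minimizers of E_{ε,A} over Borel probability measures on S consists of exactly two distinct measures μ̄⁺ and μ̄⁻, which are antipodal images of each other: μ̄⁻ = S_#μ̄⁺, where S : S → S is the antipodal map S(x) = −x and S_#μ denotes the pushforward of μ by S. -/

import Mathlib

open MeasureTheory Real Filter Topology

noncomputable section

/-- The unit sphere `S = 𝕊^{d-1}` in `ℝ^d`. -/
abbrev Sph (d : ℕ) : Type := Metric.sphere (0 : EuclideanSpace ℝ (Fin d)) 1

variable {d : ℕ}

/-- The bilinear form `⟨x, A y⟩` for the diagonal matrix `A = diag lam`. -/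
def qA (lam : Fin d → ℝ) (x y : EuclideanSpace ℝ (Fin d)) : ℝ :=
  ∑ i, lam i * x i * y i

/-- The interaction kernel `K_A(x,y) = exp ⟨x, A y⟩`. -/
def Kker (lam : Fin d → ℝ) (x y : Sph d) : ℝ :=
  Real.exp (qA lam (x : EuclideanSpace ℝ (Fin d)) (y : EuclideanSpace ℝ (Fin d)))

/-- The interaction energy `I_A(μ)`. -/
def IA (lam : Fin d → ℝ) (μ : Measure (Sph d)) : ℝ :=
  ∫ x, ∫ y, Kker lam x y ∂μ ∂μ

/-- The potential `W_μ(x) = ∫ K_A(x,y) dμ(y)`. -/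
def WA (lam : Fin d → ℝ) (μ : Measure (Sph d)) (x : Sph d) : ℝ :=
  ∫ y, Kker lam x y ∂μ

open scoped Classical in
/-- Relative entropy of `μ` with respect to `ω`, with value `+∞` when `μ` is not
absolutely continuous w.r.t. `ω` or the entropy integral diverges. -/
def Ent (ω μ : Measure (Sph d)) : EReal :=
  if μ ≪ ω ∧ Integrable (fun x => Real.log (μ.rnDeriv ω x).toReal) μ
  then ((∫ x, Real.log (μ.rnDeriv ω x).toReal ∂μ : ℝ) : EReal)
  else ⊤

/-- The free energy `E_{ε,A}(μ) = ε·Ent(μ) − (1/2)·I_A(μ)`. -/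
def EA (lam : Fin d → ℝ) (ω : Measure (Sph d)) (ε : ℝ) (μ : Measure (Sph d)) : EReal :=
  (ε : EReal) * Ent ω μ - ((IA lam μ / 2 : ℝ) : EReal)

/-- The antipodal map on the sphere. -/
def antip (x : Sph d) : Sph d :=
  ⟨-(x : EuclideanSpace ℝ (Fin d)), by
    have hx := x.2
    rw [mem_sphere_zero_iff_norm] at hx ⊢
    rwa [norm_neg]⟩

/-- The sphere self-map induced by a linear isometry equivalence of `ℝ^d`. -/
def sphMap (g : EuclideanSpace ℝ (Fin d) ≃ₗᵢ[ℝ] EuclideanSpace ℝ (Fin d)) (x : Sph d) : Sph d :=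
  ⟨g (x : EuclideanSpace ℝ (Fin d)), by
    have hx := x.2
    rw [mem_sphere_zero_iff_norm] at hx ⊢
    rwa [g.norm_map]⟩

/-- `ω` is the uniform probability measure on the sphere, characterised as a
rotation-invariant Borel probability measure. -/
def IsUniform (ω : Measure (Sph d)) : Prop :=
  IsProbabilityMeasure ω ∧
  ∀ g : EuclideanSpace ℝ (Fin d) ≃ₗᵢ[ℝ] EuclideanSpace ℝ (Fin d),
    Measure.map (sphMap g) ω = ω

/-- The (topological) support of a measure. -/
def msupport (μ : Measure (Sph d)) : Set (Sph d) :=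
  {x | ∀ U : Set (Sph d), IsOpen U → x ∈ U → 0 < μ U}

/-- The set of global maximizers of the potential `W_ν`. -/
def argmaxW (lam : Fin d → ℝ) (ν : Measure (Sph d)) : Set (Sph d) :=
  {x | ∀ y, WA lam ν y ≤ WA lam ν x}

/-- `μ` is a Gibbs critical point of `E_{ε,A}`. -/
def IsGibbs (lam : Fin d → ℝ) (ω : Measure (Sph d)) (ε : ℝ) (μ : Measure (Sph d)) : Prop :=
  IsProbabilityMeasure μ ∧
  μ = ω.withDensity (fun x => ENNReal.ofReal
    (Real.exp (WA lam μ x / ε) / ∫ z, Real.exp (WA lam μ z / ε) ∂ω))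

/-- `μ` is a global minimizer of `E_{ε,A}` over Borel probability measures. -/
def IsMinimizer (lam : Fin d → ℝ) (ω : Measure (Sph d)) (ε : ℝ) (μ : Measure (Sph d)) : Prop :=
  IsProbabilityMeasure μ ∧
  ∀ ν : Measure (Sph d), IsProbabilityMeasure ν → EA lam ω ε μ ≤ EA lam ω ε ν

/-- `m_ε`, the infimum of the free energy over probability measures. -/
def mEps (lam : Fin d → ℝ) (ω : Measure (Sph d)) (ε : ℝ) : EReal :=
  sInf {r : EReal | ∃ μ : Measure (Sph d), IsProbabilityMeasure μ ∧ EA lam ω ε μ = r}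



lemma ci {X : Type*} [TopologicalSpace X] [CompactSpace X] [MeasurableSpace X]
    [OpensMeasurableSpace X] [SecondCountableTopology X] {f : X → ℝ} (hf : Continuous f)
    (μ : Measure X) [IsFiniteMeasure μ] : Integrable f μ := by
  obtain ⟨C, hC⟩ := isCompact_univ.exists_bound_of_continuousOn (f := f) hf.continuousOn
  exact Integrable.of_bound hf.aestronglyMeasurable C (ae_of_all _ fun x => hC x (Set.mem_univ _))

lemma cont_coord (i : Fin d) : Continuous (fun x : Sph d => (x : EuclideanSpace ℝ (Fin d)) i) := by
  fun_prop

lemma sum_sq (x : Sph d) : ∑ i, (x : EuclideanSpace ℝ (Fin d)) i ^ 2 = 1 := by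
  have h := x.2
  rw [mem_sphere_zero_iff_norm] at h
  have := EuclideanSpace.real_norm_sq_eq (x : EuclideanSpace ℝ (Fin d))
  rw [h] at this
  simpa using this.symm

lemma coord_sq_le (x : Sph d) (i : Fin d) : (x : EuclideanSpace ℝ (Fin d)) i ^ 2 ≤ 1 := by
  exact (Finset.single_le_sum (f := fun i => (x : EuclideanSpace ℝ (Fin d)) i ^ 2)
    (fun i _ => sq_nonneg _) (Finset.mem_univ i)).trans_eq (sum_sq x)

lemma coord_abs_le (x : Sph d) (i : Fin d) : |(x : EuclideanSpace ℝ (Fin d)) i| ≤ 1 := by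
  have := coord_sq_le x i
  exact (sq_le_one_iff_abs_le_one _).1 this

lemma cont_qA (lam : Fin d → ℝ) : Continuous (fun p : Sph d × Sph d => qA lam p.1 p.2) := by
  unfold qA; fun_prop

lemma cont_K (lam : Fin d → ℝ) : Continuous (fun p : Sph d × Sph d => Kker lam p.1 p.2) := by
  unfold Kker; exact (cont_qA lam).rexp

lemma qA_symm (lam : Fin d → ℝ) (x y : EuclideanSpace ℝ (Fin d)) : qA lam x y = qA lam y x := by
  unfold qA; congr 1; ext i; ring

lemma K_symm (lam : Fin d → ℝ) (x y : Sph d) : Kker lam x y = Kker lam y x := by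
  unfold Kker; rw [qA_symm]

lemma K_pos (lam : Fin d → ℝ) (x y : Sph d) : 0 < Kker lam x y := exp_pos _

lemma qA_abs_le (lam : Fin d → ℝ) (hpos : ∀ i, 0 < lam i) (x y : Sph d) :
    |qA lam x y| ≤ ∑ i, lam i := by
  unfold qA
  refine (Finset.abs_sum_le_sum_abs _ _).trans (Finset.sum_le_sum fun i _ => ?_)
  rw [abs_mul, abs_mul, abs_of_pos (hpos i)]
  have h1 := coord_abs_le x i
  have h2 := coord_abs_le y i
  have := mul_le_mul h1 h2 (abs_nonneg _) zero_le_one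
  have := mul_le_mul_of_nonneg_left this (hpos i).le
  nlinarith

/-- distance to the pole -/
def rr (i0 : Fin d) (x : Sph d) : ℝ := √(2 * (1 - (x : EuclideanSpace ℝ (Fin d)) i0))

lemma rr_nonneg (i0 : Fin d) (x : Sph d) : 0 ≤ rr i0 x := sqrt_nonneg _

lemma rr_sq (i0 : Fin d) (x : Sph d) : rr i0 x ^ 2 = 2 * (1 - (x : EuclideanSpace ℝ (Fin d)) i0) := by
  unfold rr
  rw [sq_sqrt]
  have := (abs_le.1 (coord_abs_le x i0)).2
  linarith

lemma x0_eq (i0 : Fin d) (x : Sph d) : (x : EuclideanSpace ℝ (Fin d)) i0 = 1 - rr i0 x ^ 2 / 2 := by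
  rw [rr_sq]; ring

lemma rr_le (i0 : Fin d) (x : Sph d) : rr i0 x ≤ 2 := by
  have h := rr_sq i0 x
  have := (abs_le.1 (coord_abs_le x i0)).1
  nlinarith [rr_nonneg i0 x]

lemma cont_rr (i0 : Fin d) : Continuous (rr i0 : Sph d → ℝ) := by
  unfold rr; fun_prop

lemma sum_rest (i0 : Fin d) (x : Sph d) :
    ∑ i ∈ Finset.univ.erase i0, (x : EuclideanSpace ℝ (Fin d)) i ^ 2
      = rr i0 x ^ 2 - rr i0 x ^ 4 / 4 := by
  have h := sum_sq x
  rw [← Finset.add_sum_erase _ _ (Finset.mem_univ i0), x0_eq] at h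
  linear_combination h

lemma coord_le_rr (i0 : Fin d) (x : Sph d) {i : Fin d} (hi : i ≠ i0) :
    |(x : EuclideanSpace ℝ (Fin d)) i| ≤ rr i0 x := by
  apply abs_le_of_sq_le_sq _ (rr_nonneg _ _)
  have h := sum_rest i0 x
  have := Finset.single_le_sum (f := fun i => (x : EuclideanSpace ℝ (Fin d)) i ^ 2)
    (fun i _ => sq_nonneg _) (Finset.mem_erase.2 ⟨hi, Finset.mem_univ i⟩)
  simp only at this
  nlinarith [sq_nonneg (rr i0 x ^ 2)]

/-- transversal bilinear form -/
def BB (lam : Fin d → ℝ) (i0 : Fin d) (x y : Sph d) : ℝ :=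
  ∑ i ∈ Finset.univ.erase i0, lam i * (x : EuclideanSpace ℝ (Fin d)) i * (y : EuclideanSpace ℝ (Fin d)) i

lemma qA_split (lam : Fin d → ℝ) (i0 : Fin d) (x y : Sph d) :
    qA lam x y = lam i0 * (1 - rr i0 x ^ 2 / 2) * (1 - rr i0 y ^ 2 / 2) + BB lam i0 x y := by
  unfold qA BB
  rw [← Finset.add_sum_erase _ _ (Finset.mem_univ i0), ← x0_eq, ← x0_eq]

lemma BB_le (lam : Fin d → ℝ) (hpos : ∀ i, 0 < lam i) (i0 : Fin d) (x y : Sph d) :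
    |BB lam i0 x y| ≤ (∑ i, lam i) * (rr i0 x * rr i0 y) := by
  unfold BB
  refine (Finset.abs_sum_le_sum_abs _ _).trans ?_
  rw [Finset.sum_mul]
  refine (Finset.sum_le_sum fun i hi => ?_).trans (Finset.sum_le_sum_of_subset_of_nonneg
    (Finset.erase_subset i0 _) (fun i _ _ => mul_nonneg (hpos i).le
      (mul_nonneg (rr_nonneg _ _) (rr_nonneg _ _))))
  have hi' := (Finset.mem_erase.1 hi).1
  rw [abs_mul, abs_mul, abs_of_pos (hpos i), mul_assoc]
  exact mul_le_mul_of_nonneg_left (mul_le_mul (coord_le_rr i0 x hi') (coord_le_rr i0 y hi')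
    (abs_nonneg _) (rr_nonneg _ _)) (hpos i).le

lemma exp_sub_one_le {t M : ℝ} (h : |t| ≤ M) : |exp t - 1| ≤ exp M * |t| := by
  have h1 : t + 1 ≤ exp t := add_one_le_exp t
  have h2 : -t + 1 ≤ exp (-t) := add_one_le_exp (-t)
  have h3 : exp t * exp (-t) = 1 := by rw [← exp_add]; simp
  have h4 : exp t ≤ exp M := exp_le_exp.2 ((le_abs_self t).trans h)
  have h5 : (1:ℝ) ≤ exp M := one_le_exp ((abs_nonneg t).trans h)
  have h6 : exp t - 1 ≤ exp t * t := by nlinarith [exp_pos t]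
  rw [abs_le]
  constructor
  · nlinarith [neg_abs_le t, abs_nonneg t]
  · nlinarith [le_abs_self t, abs_nonneg t, mul_le_mul h4 (le_abs_self t), exp_pos t, exp_pos M,
      mul_le_mul_of_nonneg_left (le_abs_self t) (exp_pos t).le,
      mul_le_mul_of_nonneg_right h4 (abs_nonneg t)]

lemma exp_sub_one_sub_le {t M : ℝ} (h : |t| ≤ M) : |exp t - 1 - t| ≤ exp M * t ^ 2 := by
  have h1 : t + 1 ≤ exp t := add_one_le_exp t
  rw [abs_of_nonneg (by linarith)]
  have h2 := exp_sub_one_le h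
  have h2 : -t + 1 ≤ exp (-t) := add_one_le_exp (-t)
  have h3 : exp t * exp (-t) = 1 := by rw [← exp_add]; simp
  have h6 : exp t - 1 ≤ exp t * t := by nlinarith [exp_pos t]
  have h7 : t * (exp t - 1) ≤ |exp t - 1| * |t| := by
    rw [← abs_mul, mul_comm]; exact le_abs_self _
  have h8 := mul_le_mul_of_nonneg_right (exp_sub_one_le h) (abs_nonneg t)
  have : |t| * |t| = t ^ 2 := by rw [abs_mul_abs_self]; ring
  rw [mul_assoc, this] at h8
  linarith

/-- first kernel estimate -/
lemma K_est1 (lam : Fin d → ℝ) (hpos : ∀ i, 0 < lam i) (i0 : Fin d) :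
    ∃ C, 0 < C ∧ ∀ x y : Sph d,
      |Kker lam x y - exp (lam i0)| ≤ C * (rr i0 x ^ 2 + rr i0 y ^ 2) ∧
      |(y : EuclideanSpace ℝ (Fin d)) i0 * Kker lam x y - exp (lam i0)|
        ≤ C * (rr i0 x ^ 2 + rr i0 y ^ 2) ∧
      |(x : EuclideanSpace ℝ (Fin d)) i0 * Kker lam x y - exp (lam i0)|
        ≤ C * (rr i0 x ^ 2 + rr i0 y ^ 2) := by
  set Λ := ∑ i, lam i with hΛ
  have hl : lam i0 ≤ Λ := Finset.single_le_sum (fun i _ => (hpos i).le) (Finset.mem_univ i0)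
  have hΛ0 : 0 < Λ := (hpos i0).trans_le hl
  have base : ∀ x y : Sph d, |Kker lam x y - exp (lam i0)| ≤
      exp Λ * exp (2 * Λ) * (4 * Λ) * (rr i0 x ^ 2 + rr i0 y ^ 2) := by
    intro x y
    have hq := qA_abs_le lam hpos x y
    have ht : |qA lam x y - lam i0| ≤ 2 * Λ := by
      have := abs_sub (qA lam x y) (lam i0)
      rw [abs_of_pos (hpos i0)] at this
      linarith
    have e : Kker lam x y - exp (lam i0) = exp (lam i0) * (exp (qA lam x y - lam i0) - 1) := by
      unfold Kker
      rw [exp_sub]; field_simp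
    have hB := BB_le lam hpos i0 x y
    have hr := rr_nonneg i0 x
    have hs := rr_nonneg i0 y
    have hr2 := rr_le i0 x
    have hs2 := rr_le i0 y
    generalize hR : rr i0 x = r at *
    generalize hS : rr i0 y = s at *
    have hb : |qA lam x y - lam i0| ≤ 4 * Λ * (r ^ 2 + s ^ 2) := by
      rw [qA_split lam i0, hR, hS]
      have e2 : lam i0 * (1 - r ^ 2 / 2) * (1 - s ^ 2 / 2) + BB lam i0 x y - lam i0
        = lam i0 * (-(r^2/2) - s^2/2 + r^2*s^2/4) + BB lam i0 x y := by ring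
      rw [e2]
      have h1 : |(-(r^2/2) - s^2/2 + r^2*s^2/4)| ≤ 2 * (r^2+s^2) := by
        rw [abs_le]; constructor <;> nlinarith [sq_nonneg r, sq_nonneg s, mul_nonneg hr hs, mul_nonneg (sq_nonneg r) (sq_nonneg s), mul_nonneg (sq_nonneg r) (sub_nonneg.2 hs2), mul_nonneg (mul_nonneg (sq_nonneg r) hs) (sub_nonneg.2 hs2)]
      calc _ ≤ lam i0 * |(-(r^2/2) - s^2/2 + r^2*s^2/4)| + |BB lam i0 x y| := by
            refine (abs_add_le _ _).trans ?_
            rw [abs_mul, abs_of_pos (hpos i0)]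
        _ ≤ Λ * (2 * (r^2+s^2)) + Λ * (r * s) := by
            refine add_le_add (mul_le_mul hl h1 (abs_nonneg _) hΛ0.le) hB
        _ ≤ _ := by nlinarith [mul_nonneg hΛ0.le (sq_nonneg (r - s)), mul_nonneg hΛ0.le (sq_nonneg (r + s)), mul_nonneg hΛ0.le (sq_nonneg r)]
    rw [e, abs_mul, abs_of_pos (exp_pos _)]
    calc _ ≤ exp Λ * (exp (2 * Λ) * (4 * Λ * (r ^ 2 + s ^ 2))) := by
          refine mul_le_mul (exp_le_exp.2 hl) ((exp_sub_one_le ht).trans ?_) (abs_nonneg _) (exp_pos _).le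
          exact mul_le_mul_of_nonneg_left hb (exp_pos _).le
      _ = _ := by ring
  set C0 := exp Λ * exp (2 * Λ) * (4 * Λ) with hC0
  have hC0p : 0 < C0 := by positivity
  have hKb : ∀ x y : Sph d, Kker lam x y ≤ exp Λ := fun x y =>
    exp_le_exp.2 ((le_abs_self _).trans (qA_abs_le lam hpos x y))
  refine ⟨C0 + exp Λ, by positivity, fun x y => ⟨?_, ?_, ?_⟩⟩
  · refine (base x y).trans (mul_le_mul_of_nonneg_right ?_ (by positivity))
    linarith [exp_pos Λ]
  · have e : (y : EuclideanSpace ℝ (Fin d)) i0 * Kker lam x y - exp (lam i0)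
        = (Kker lam x y - exp (lam i0)) - rr i0 y ^ 2 / 2 * Kker lam x y := by
      rw [x0_eq i0 y]; ring
    rw [e]
    refine (abs_sub _ _).trans ?_
    rw [abs_of_nonneg (a := rr i0 y ^ 2 / 2 * Kker lam x y) (mul_nonneg (by positivity) (K_pos _ _ _).le)]
    have := base x y
    have h2 := mul_le_mul_of_nonneg_left (hKb x y) (sq_nonneg (rr i0 y))
    nlinarith [exp_pos Λ, mul_nonneg (exp_pos Λ).le (sq_nonneg (rr i0 x)), mul_nonneg (exp_pos Λ).le (sq_nonneg (rr i0 y))]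
  · have e : (x : EuclideanSpace ℝ (Fin d)) i0 * Kker lam x y - exp (lam i0)
        = (Kker lam x y - exp (lam i0)) - rr i0 x ^ 2 / 2 * Kker lam x y := by
      rw [x0_eq i0 x]; ring
    rw [e]
    refine (abs_sub _ _).trans ?_
    rw [abs_of_nonneg (a := rr i0 x ^ 2 / 2 * Kker lam x y) (mul_nonneg (by positivity) (K_pos _ _ _).le)]
    have := base x y
    have h2 := mul_le_mul_of_nonneg_left (hKb x y) (sq_nonneg (rr i0 x))
    nlinarith [exp_pos Λ, mul_nonneg (exp_pos Λ).le (sq_nonneg (rr i0 x)), mul_nonneg (exp_pos Λ).le (sq_nonneg (rr i0 y))]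

/-- one-variable factor -/
def al (lam : Fin d → ℝ) (i0 : Fin d) (x : Sph d) : ℝ := exp (-(lam i0 * rr i0 x ^ 2 / 2))

lemma cont_al (lam : Fin d → ℝ) (i0 : Fin d) : Continuous (al lam i0 : Sph d → ℝ) := by
  unfold al
  have := cont_rr i0
  fun_prop

set_option maxHeartbeats 1000000 in
/-- second kernel estimate -/
lemma K_est2 (lam : Fin d → ℝ) (hpos : ∀ i, 0 < lam i) (i0 : Fin d) :
    ∃ C, 0 < C ∧ ∀ x y : Sph d,
      |Kker lam x y - exp (lam i0) * (al lam i0 x + al lam i0 y - 1 + BB lam i0 x y)|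
        ≤ C * (rr i0 x ^ 2 * rr i0 y + rr i0 x * rr i0 y ^ 2) := by
  set Λ := ∑ i, lam i with hΛ
  have hl : lam i0 ≤ Λ := Finset.single_le_sum (fun i _ => (hpos i).le) (Finset.mem_univ i0)
  have hΛ0 : 0 < Λ := (hpos i0).trans_le hl
  refine ⟨exp Λ * (Λ ^ 2 + exp (8 * Λ) * 4 * Λ ^ 2 + Λ * (2 * Λ) + Λ) , by positivity, fun x y => ?_⟩
  have hB := BB_le lam hpos i0 x y
  have hr := rr_nonneg i0 x
  have hs := rr_nonneg i0 y
  have hr2 := rr_le i0 x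
  have hs2 := rr_le i0 y
  have hK : Kker lam x y = exp (lam i0) * (al lam i0 x * al lam i0 y *
      exp (lam i0 * rr i0 x ^ 2 * rr i0 y ^ 2 / 4 + BB lam i0 x y)) := by
    unfold Kker al
    rw [qA_split lam i0, ← exp_add, ← exp_add, ← exp_add]
    congr 1; ring
  have hα : ∀ z : Sph d, 0 < al lam i0 z ∧ al lam i0 z ≤ 1 ∧ 1 - al lam i0 z ≤ Λ * rr i0 z ^ 2 / 2 := by
    intro z
    refine ⟨exp_pos _, ?_, ?_⟩
    · unfold al
      rw [exp_le_one_iff]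
      have := mul_nonneg (hpos i0).le (sq_nonneg (rr i0 z)); linarith
    · have : -(lam i0 * rr i0 z ^ 2 / 2) + 1 ≤ al lam i0 z := add_one_le_exp _
      have := mul_le_mul_of_nonneg_right hl (sq_nonneg (rr i0 z))
      linarith
  obtain ⟨a1, a2, a3⟩ := hα x
  obtain ⟨b1, b2, b3⟩ := hα y
  generalize rr i0 x = r at *
  generalize rr i0 y = s at *
  generalize al lam i0 x = a at *
  generalize al lam i0 y = b at *
  generalize hbb : BB lam i0 x y = B at *
  set D := lam i0 * r ^ 2 * s ^ 2 / 4 + B with hD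
  have hrs : 0 ≤ r * s := mul_nonneg hr hs
  have hrs4 : r * s ≤ 4 := by nlinarith
  have hDB : |D - B| ≤ Λ * (r * s) ^ 2 / 4 := by
    have : D - B = lam i0 * (r * s) ^ 2 / 4 := by rw [hD]; ring
    rw [this, abs_of_nonneg (by have := mul_nonneg (hpos i0).le (sq_nonneg (r*s)); linarith)]
    have := mul_le_mul_of_nonneg_right hl (sq_nonneg (r*s)); linarith
  have hDl : |D| ≤ 2 * Λ * (r * s) := by
    have e : D = (D - B) + B := by ring
    rw [e]
    refine (abs_add_le _ _).trans ?_
    nlinarith [mul_nonneg hΛ0.le hrs, mul_nonneg (mul_nonneg hΛ0.le hrs) (sub_nonneg.2 hrs4)]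
  have hD8 : |D| ≤ 8 * Λ := by nlinarith [mul_le_mul_of_nonneg_left hrs4 hΛ0.le]
  have hE := exp_sub_one_sub_le hD8
  have hD2 : D ^ 2 ≤ 4 * Λ ^ 2 * (r * s) ^ 2 := by
    have := mul_self_le_mul_self (abs_nonneg D) hDl
    rw [abs_mul_abs_self] at this
    nlinarith
  rw [hK]
  have e : exp (lam i0) * (a * b * exp D) - exp (lam i0) * (a + b - 1 + B)
    = exp (lam i0) * ((1 - a) * (1 - b) + a * b * (exp D - 1 - D) + (a * b - 1) * D + (D - B)) := by ring
  rw [e, abs_mul, abs_of_pos (exp_pos _), mul_assoc (exp Λ)]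
  refine mul_le_mul (exp_le_exp.2 hl) ?_ (abs_nonneg _) (exp_pos _).le
  set T := r ^ 2 * s + r * s ^ 2 with hT
  have hT0 : 0 ≤ T := by positivity
  have hrsT : (r * s) ^ 2 ≤ T := by rw [hT]; nlinarith [mul_nonneg (mul_nonneg hr hrs) (sub_nonneg.2 hs2), mul_nonneg (mul_nonneg hrs hs) (sub_nonneg.2 hr2)]
  have t1 : |(1 - a) * (1 - b)| ≤ Λ ^ 2 * T := by
    rw [abs_of_nonneg (mul_nonneg (by linarith) (by linarith))]
    calc _ ≤ (Λ * r ^ 2 / 2) * (Λ * s ^ 2 / 2) := mul_le_mul a3 b3 (by linarith) (by positivity)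
      _ = Λ ^ 2 * ((r * s) ^ 2) / 4 := by ring
      _ ≤ _ := by
        have u1 := mul_le_mul_of_nonneg_left hrsT (sq_nonneg Λ)
        have u2 := mul_nonneg (sq_nonneg Λ) hT0
        linarith
  have hab0 : 0 ≤ a * b := by positivity
  have hab1 : a * b ≤ 1 := by nlinarith
  have t2 : |a * b * (exp D - 1 - D)| ≤ exp (8 * Λ) * 4 * Λ ^ 2 * T := by
    rw [abs_mul, abs_of_nonneg hab0]
    calc _ ≤ 1 * (exp (8 * Λ) * (4 * Λ ^ 2 * T)) := by
          refine mul_le_mul hab1 (hE.trans (mul_le_mul_of_nonneg_left (hD2.trans ?_) (exp_pos _).le)) (abs_nonneg _) zero_le_one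
          exact mul_le_mul_of_nonneg_left hrsT (by positivity)
      _ = _ := by ring
  have t3 : |(a * b - 1) * D| ≤ Λ * (2 * Λ) * T := by
    rw [abs_mul, abs_sub_comm, abs_of_nonneg (by linarith)]
    have h1 : 1 - a * b ≤ Λ * (r^2 + s^2) / 2 := by nlinarith
    calc _ ≤ (Λ * (r^2 + s^2) / 2) * (2 * Λ * (r * s)) := mul_le_mul h1 hDl (abs_nonneg _) (by positivity)
      _ = Λ * (2 * Λ) * ((r^2 + s^2) * (r * s) / 2) := by ring
      _ ≤ _ := by
        refine mul_le_mul_of_nonneg_left ?_ (by positivity)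
        rw [hT]; nlinarith [mul_nonneg (mul_nonneg hr hrs) (sub_nonneg.2 hr2), mul_nonneg (mul_nonneg hrs hs) (sub_nonneg.2 hs2)]
  have t4 : |D - B| ≤ Λ * T := by
    refine hDB.trans ?_
    have u1 := mul_le_mul_of_nonneg_left hrsT hΛ0.le
    have u2 := mul_nonneg hΛ0.le hT0
    linarith
  calc _ ≤ |(1 - a) * (1 - b)| + |a * b * (exp D - 1 - D)| + |(a * b - 1) * D| + |D - B| := by
        refine (abs_add_le _ _).trans (add_le_add_left ((abs_add_le _ _).trans (add_le_add_left (abs_add_le _ _) _)) _)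
    _ ≤ _ := by linarith


lemma cs_cont {X : Type*} [TopologicalSpace X] [CompactSpace X] [MeasurableSpace X]
    [OpensMeasurableSpace X] [SecondCountableTopology X] {f g : X → ℝ} (hf : Continuous f)
    (hg : Continuous g) (μ : Measure X) [IsFiniteMeasure μ] :
    (∫ x, f x * g x ∂μ) ^ 2 ≤ (∫ x, f x ^ 2 ∂μ) * ∫ x, g x ^ 2 ∂μ := by
  have key : ∀ t : ℝ, 0 ≤ (∫ x, g x ^ 2 ∂μ) * (t * t) + (2 * ∫ x, f x * g x ∂μ) * t
      + ∫ x, f x ^ 2 ∂μ := by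
    intro t
    have h1 : 0 ≤ ∫ x, (f x + t * g x) ^ 2 ∂μ := integral_nonneg fun x => sq_nonneg _
    have h2 : ∫ x, (f x + t * g x) ^ 2 ∂μ = ∫ x, (f x ^ 2 + (2 * t) * (f x * g x)) + (t * t) * (g x ^ 2) ∂μ := by
      congr 1; ext x; ring
    rw [h2, integral_add (ci (by fun_prop) μ) (ci (by fun_prop) μ),
      integral_add (ci (by fun_prop) μ) (ci (by fun_prop) μ), integral_const_mul, integral_const_mul] at h1
    linarith
  have := discrim_le_zero key
  unfold discrim at this
  linarith

lemma jensen_sq {X : Type*} [TopologicalSpace X] [CompactSpace X] [MeasurableSpace X]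
    [OpensMeasurableSpace X] [SecondCountableTopology X] {f : X → ℝ} (hf : Continuous f)
    (μ : Measure X) [IsProbabilityMeasure μ] :
    (∫ x, f x ∂μ) ^ 2 ≤ ∫ x, f x ^ 2 ∂μ := by
  have := cs_cont hf (continuous_const (y := (1:ℝ))) μ
  simpa using this

lemma spectral (lam : Fin d → ℝ) (hpos : ∀ i, 0 < lam i) (i0 : Fin d) (l2 : ℝ) (hl20 : 0 ≤ l2)
    (hl2 : ∀ i, i ≠ i0 → lam i ≤ l2) :
    ∃ C, 0 < C ∧ ∀ (ρ : Measure (Sph d)) [IsProbabilityMeasure ρ] (g : Sph d → ℝ) (σ τ : ℝ),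
      Continuous g → ∫ x, g x ∂ρ = 0 → 0 ≤ σ → 0 ≤ τ →
      (∀ i j, i ≠ i0 → j ≠ i0 →
        |∫ x : Sph d, (x : EuclideanSpace ℝ (Fin d)) i * (x : EuclideanSpace ℝ (Fin d)) j ∂ρ
          - (if i = j then σ else 0)| ≤ τ) →
      ∫ p, Kker lam p.1 p.2 * (g p.1 * g p.2) ∂(ρ.prod ρ)
        ≤ (exp (lam i0) * (l2 * (σ + d * τ))
          + C * (√(∫ x, rr i0 x ^ 4 ∂ρ) * √(∫ x, rr i0 x ^ 2 ∂ρ))) * ∫ x, g x ^ 2 ∂ρ := by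
  obtain ⟨C, hC, hK⟩ := K_est2 lam hpos i0
  refine ⟨2 * C, by positivity, ?_⟩
  intro ρ _ g σ τ hg hg0 hσ hτ hS
  have cK := cont_K lam
  have cr := cont_rr i0
  have ca := cont_al lam i0
  set G := ∫ x, g x ^ 2 ∂ρ with hG
  have hG0 : 0 ≤ G := integral_nonneg fun x => sq_nonneg _
  set E := exp (lam i0) with hE
  have cB : Continuous (fun p : Sph d × Sph d => BB lam i0 p.1 p.2) := by unfold BB; fun_prop
  -- split
  have hsplit : ∫ p, Kker lam p.1 p.2 * (g p.1 * g p.2) ∂(ρ.prod ρ)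
      = (∫ p, (Kker lam p.1 p.2 - E * (al lam i0 p.1 + al lam i0 p.2 - 1 + BB lam i0 p.1 p.2)) * (g p.1 * g p.2) ∂(ρ.prod ρ))
      + E * (((∫ p : Sph d × Sph d, (al lam i0 p.1 * g p.1) * g p.2 ∂(ρ.prod ρ))
        + ∫ p : Sph d × Sph d, g p.1 * (al lam i0 p.2 * g p.2) ∂(ρ.prod ρ))
        - ∫ p : Sph d × Sph d, g p.1 * g p.2 ∂(ρ.prod ρ))
      + E * ∫ p : Sph d × Sph d, BB lam i0 p.1 p.2 * (g p.1 * g p.2) ∂(ρ.prod ρ) := by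
    rw [← integral_add (ci (by fun_prop) _) (ci (by fun_prop) _),
      ← integral_sub (ci (by fun_prop) _) (ci (by fun_prop) _), ← integral_const_mul, ← integral_const_mul,
      ← integral_add (ci (by fun_prop) _) (ci (by fun_prop) _), ← integral_add (ci (by fun_prop) _) (ci (by fun_prop) _)]
    congr 1; ext p; ring
  rw [hsplit, integral_prod_mul (μ := ρ) (ν := ρ) (fun x => al lam i0 x * g x) g,
    integral_prod_mul (μ := ρ) (ν := ρ) g (fun x => al lam i0 x * g x),
    integral_prod_mul (μ := ρ) (ν := ρ) g g, hg0]
  -- first term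
  have h1 : ∫ p, (Kker lam p.1 p.2 - E * (al lam i0 p.1 + al lam i0 p.2 - 1 + BB lam i0 p.1 p.2)) * (g p.1 * g p.2) ∂(ρ.prod ρ)
      ≤ 2 * C * (√(∫ x, rr i0 x ^ 4 ∂ρ) * √(∫ x, rr i0 x ^ 2 ∂ρ)) * G := by
    have a1 : ∫ p, (Kker lam p.1 p.2 - E * (al lam i0 p.1 + al lam i0 p.2 - 1 + BB lam i0 p.1 p.2)) * (g p.1 * g p.2) ∂(ρ.prod ρ)
      ≤ ∫ p : Sph d × Sph d, C * ((rr i0 p.1 ^ 2 * |g p.1|) * (rr i0 p.2 * |g p.2|) + (rr i0 p.1 * |g p.1|) * (rr i0 p.2 ^ 2 * |g p.2|)) ∂(ρ.prod ρ) := by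
      refine integral_mono (ci (by fun_prop) _) (ci (by fun_prop) _) fun p => ?_
      simp only
      refine (le_abs_self _).trans ?_
      rw [abs_mul, abs_mul]
      refine (mul_le_mul_of_nonneg_right (hK p.1 p.2) (by positivity)).trans (le_of_eq ?_)
      ring
    rw [integral_const_mul, integral_add (ci (by fun_prop) _) (ci (by fun_prop) _),
      integral_prod_mul (μ := ρ) (ν := ρ) (fun x => rr i0 x ^ 2 * |g x|) (fun x => rr i0 x * |g x|),
      integral_prod_mul (μ := ρ) (ν := ρ) (fun x => rr i0 x * |g x|) (fun x => rr i0 x ^ 2 * |g x|)] at a1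
    have b1 : ∫ x, rr i0 x ^ 2 * |g x| ∂ρ ≤ √(∫ x, rr i0 x ^ 4 ∂ρ) * √G := by
      rw [← sqrt_mul' _ hG0]
      apply le_sqrt_of_sq_le
      have := cs_cont (f := fun x => rr i0 x ^ 2) (g := fun x => |g x|) (by fun_prop) (by fun_prop) ρ
      simpa [← pow_mul] using this
    have b2 : ∫ x, rr i0 x * |g x| ∂ρ ≤ √(∫ x, rr i0 x ^ 2 ∂ρ) * √G := by
      rw [← sqrt_mul' _ hG0]
      apply le_sqrt_of_sq_le
      have := cs_cont (f := fun x => rr i0 x) (g := fun x => |g x|) (by fun_prop) (by fun_prop) ρ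
      simpa using this
    have n2 : 0 ≤ ∫ x, rr i0 x * |g x| ∂ρ := integral_nonneg fun x => mul_nonneg (rr_nonneg _ _) (abs_nonneg _)
    have b3 := mul_le_mul b1 b2 n2 (by positivity)
    have b4 : √(∫ x, rr i0 x ^ 4 ∂ρ) * √G * (√(∫ x, rr i0 x ^ 2 ∂ρ) * √G)
       = (√(∫ x, rr i0 x ^ 4 ∂ρ) * √(∫ x, rr i0 x ^ 2 ∂ρ)) * G := by
      have := mul_self_sqrt hG0
      linear_combination (√(∫ x, rr i0 x ^ 4 ∂ρ) * √(∫ x, rr i0 x ^ 2 ∂ρ)) * this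
    rw [b4] at b3
    have b5 := mul_le_mul_of_nonneg_left b3 hC.le
    nlinarith
  -- third term
  set v : Fin d → ℝ := fun i => ∫ x : Sph d, (x : EuclideanSpace ℝ (Fin d)) i * g x ∂ρ with hv
  have h3 : ∫ p : Sph d × Sph d, BB lam i0 p.1 p.2 * (g p.1 * g p.2) ∂(ρ.prod ρ)
      = ∑ i ∈ Finset.univ.erase i0, lam i * v i ^ 2 := by
    have : ∀ p : Sph d × Sph d, BB lam i0 p.1 p.2 * (g p.1 * g p.2) =
        ∑ i ∈ Finset.univ.erase i0, lam i * (((p.1 : EuclideanSpace ℝ (Fin d)) i * g p.1) * ((p.2 : EuclideanSpace ℝ (Fin d)) i * g p.2)) := by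
      intro p
      unfold BB
      rw [Finset.sum_mul]
      refine Finset.sum_congr rfl fun i _ => ?_
      ring
    simp_rw [this]
    rw [integral_finsetSum _ (fun i _ => ci (by fun_prop) _)]
    refine Finset.sum_congr rfl fun i _ => ?_
    rw [integral_const_mul, integral_prod_mul (μ := ρ) (ν := ρ) (fun x : Sph d => (x : EuclideanSpace ℝ (Fin d)) i * g x) (fun x : Sph d => (x : EuclideanSpace ℝ (Fin d)) i * g x)]
    simp only [hv]; ring
  set V := ∑ i ∈ Finset.univ.erase i0, v i ^ 2 with hV
  have hV0 : 0 ≤ V := Finset.sum_nonneg fun i _ => sq_nonneg _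
  have hVG : V ≤ (σ + d * τ) * G := by
    have c1 : V = ∫ x : Sph d, (∑ i ∈ Finset.univ.erase i0, v i * (x : EuclideanSpace ℝ (Fin d)) i) * g x ∂ρ := by
      simp_rw [Finset.sum_mul]
      rw [integral_finsetSum _ (fun i _ => ci (by fun_prop) _)]
      refine Finset.sum_congr rfl fun i _ => ?_
      simp_rw [mul_assoc]
      rw [integral_const_mul]; simp only [hv]; ring
    have c2 := cs_cont (f := fun x : Sph d => (∑ i ∈ Finset.univ.erase i0, v i * (x : EuclideanSpace ℝ (Fin d)) i)) (g := g) (by fun_prop) hg ρ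
    rw [← c1, ← hG] at c2
    have c3 : ∫ x : Sph d, (∑ i ∈ Finset.univ.erase i0, v i * (x : EuclideanSpace ℝ (Fin d)) i) ^ 2 ∂ρ
        = ∑ i ∈ Finset.univ.erase i0, ∑ j ∈ Finset.univ.erase i0, v i * v j *
          ∫ x : Sph d, (x : EuclideanSpace ℝ (Fin d)) i * (x : EuclideanSpace ℝ (Fin d)) j ∂ρ := by
      simp_rw [sq, Finset.sum_mul_sum]
      rw [integral_finsetSum _ (fun i _ => ci (by fun_prop) _)]
      refine Finset.sum_congr rfl fun i _ => ?_
      rw [integral_finsetSum _ (fun i _ => ci (by fun_prop) _)]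
      refine Finset.sum_congr rfl fun j _ => ?_
      rw [← integral_const_mul]
      congr 1; ext x; ring
    have c4 : ∫ x : Sph d, (∑ i ∈ Finset.univ.erase i0, v i * (x : EuclideanSpace ℝ (Fin d)) i) ^ 2 ∂ρ
        ≤ (σ + d * τ) * V := by
      rw [c3]
      have : ∀ i ∈ Finset.univ.erase i0, ∀ j ∈ Finset.univ.erase i0, v i * v j *
          ∫ x : Sph d, (x : EuclideanSpace ℝ (Fin d)) i * (x : EuclideanSpace ℝ (Fin d)) j ∂ρ
          ≤ (if i = j then v i * v j * σ else 0) + (v i ^ 2 + v j ^ 2) / 2 * τ := by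
        intro i hi j hj
        have h := hS i j (Finset.mem_erase.1 hi).1 (Finset.mem_erase.1 hj).1
        generalize ∫ x : Sph d, (x : EuclideanSpace ℝ (Fin d)) i * (x : EuclideanSpace ℝ (Fin d)) j ∂ρ = w at *
        have h2 : v i * v j * (w - (if i = j then σ else 0)) ≤ (v i ^ 2 + v j ^ 2) / 2 * τ := by
          refine (le_abs_self _).trans ?_
          rw [abs_mul]
          refine mul_le_mul ?_ h (abs_nonneg _) (by positivity)
          rw [abs_le]; constructor <;> nlinarith [sq_nonneg (v i - v j), sq_nonneg (v i + v j)]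
        split_ifs at h2 ⊢ <;> linarith
      refine (Finset.sum_le_sum fun i hi => Finset.sum_le_sum fun j hj => this i hi j hj).trans ?_
      have hcard : ((Finset.univ.erase i0).card : ℝ) ≤ d := by
        have := Finset.card_le_univ (Finset.univ.erase i0)
        rw [Fintype.card_fin] at this
        exact_mod_cast this
      have s1 : ∑ i ∈ Finset.univ.erase i0, ∑ j ∈ Finset.univ.erase i0, (if i = j then v i * v j * σ else 0) = σ * V := by
        rw [hV, Finset.mul_sum]
        refine Finset.sum_congr rfl fun i hi => ?_
        rw [Finset.sum_ite_eq, if_pos hi]; ring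
      have s2 : ∑ i ∈ Finset.univ.erase i0, ∑ j ∈ Finset.univ.erase i0, (v i ^ 2 + v j ^ 2) / 2 * τ
          = ((Finset.univ.erase i0).card : ℝ) * V * τ := by
        have : ∀ i j, (v i ^ 2 + v j ^ 2) / 2 * τ = v i ^ 2 * (τ / 2) + v j ^ 2 * (τ / 2) := by intros; ring
        simp only [this, Finset.sum_add_distrib, ← Finset.sum_mul, Finset.sum_const, nsmul_eq_mul, ← Finset.mul_sum]
        rw [← hV]; ring
      simp_rw [Finset.sum_add_distrib]
      rw [s1, s2]
      nlinarith [mul_le_mul_of_nonneg_right hcard (mul_nonneg hV0 hτ)]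
    have c5 : V ^ 2 ≤ (σ + d * τ) * V * G := c2.trans (mul_le_mul_of_nonneg_right c4 hG0)
    rcases hV0.eq_or_lt with h | h
    · rw [← h]; positivity
    · have : V * V ≤ V * ((σ + d * τ) * G) := by nlinarith
      exact le_of_mul_le_mul_left this h
  have h4 : ∑ i ∈ Finset.univ.erase i0, lam i * v i ^ 2 ≤ l2 * V := by
    rw [hV, Finset.mul_sum]
    refine Finset.sum_le_sum fun i hi => mul_le_mul_of_nonneg_right (hl2 i (Finset.mem_erase.1 hi).1) (sq_nonneg _)
  rw [h3]
  have h5 : E * ∑ i ∈ Finset.univ.erase i0, lam i * v i ^ 2 ≤ E * (l2 * ((σ + d * τ) * G)) :=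
    mul_le_mul_of_nonneg_left (h4.trans (mul_le_mul_of_nonneg_left hVG hl20)) (exp_pos _).le
  nlinarith


/-- derivative of the exponent along the rotation -/
def Lq (lam : Fin d → ℝ) (i0 i : Fin d) (x y : Sph d) : ℝ :=
  (x : EuclideanSpace ℝ (Fin d)) i0 * (lam i * (y : EuclideanSpace ℝ (Fin d)) i)
    - (x : EuclideanSpace ℝ (Fin d)) i * (lam i0 * (y : EuclideanSpace ℝ (Fin d)) i0)

lemma cont_Lq (lam : Fin d → ℝ) (i0 i : Fin d) :
    Continuous (fun p : Sph d × Sph d => Lq lam i0 i p.1 p.2) := by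
  unfold Lq; fun_prop

lemma int_fst_add_snd {f : Sph d → ℝ} (hf : Continuous f) (μ : Measure (Sph d)) [IsProbabilityMeasure μ] :
    ∫ p : Sph d × Sph d, f p.1 + f p.2 ∂(μ.prod μ) = 2 * ∫ x, f x ∂μ := by
  rw [integral_add (ci (by fun_prop) _) (ci (by fun_prop) _)]
  have h1 := integral_prod_mul (μ := μ) (ν := μ) f (fun _ => (1:ℝ))
  have h2 := integral_prod_mul (μ := μ) (ν := μ) (fun _ => (1:ℝ)) f
  simp at h1 h2
  rw [h1, h2]; ring

lemma int_swap (F : Sph d → Sph d → ℝ) (μ : Measure (Sph d)) [IsProbabilityMeasure μ] :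
    ∫ p : Sph d × Sph d, F p.1 p.2 ∂(μ.prod μ) = ∫ p : Sph d × Sph d, F p.2 p.1 ∂(μ.prod μ) := by
  exact (integral_prod_swap (μ := μ) (ν := μ) (fun p : Sph d × Sph d => F p.1 p.2)).symm

lemma approx_int {F H : Sph d × Sph d → ℝ} {f : Sph d → ℝ} (hF : Continuous F) (hH : Continuous H)
    (hf : Continuous f) (C : ℝ) (μ : Measure (Sph d)) [IsProbabilityMeasure μ]
    (h : ∀ p, |F p - H p| ≤ C * (f p.1 + f p.2)) :
    |∫ p, F p ∂(μ.prod μ) - ∫ p, H p ∂(μ.prod μ)| ≤ 2 * C * ∫ x, f x ∂μ := by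
  rw [← integral_sub (ci hF _) (ci hH _)]
  have := norm_integral_le_of_norm_le (μ := μ.prod μ) (f := fun p => F p - H p)
    (g := fun p => C * (f p.1 + f p.2)) (ci (by fun_prop) _) (ae_of_all _ h)
  rw [integral_const_mul, int_fst_add_snd hf, norm_eq_abs] at this
  linarith

set_option maxHeartbeats 1000000 in
lemma moments (lam : Fin d → ℝ) (hpos : ∀ i, 0 < lam i) (i0 : Fin d)
    (hne : ∀ i, i ≠ i0 → lam i < lam i0) :
    ∃ C, 0 < C ∧ ∀ (μ : Measure (Sph d)) [IsProbabilityMeasure μ] (ε : ℝ), 0 < ε →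
      (∀ i, i ≠ i0 → ∫ p : Sph d × Sph d, Lq lam i0 i p.1 p.2 * Kker lam p.1 p.2 ∂(μ.prod μ) = 0) →
      (∀ i j, i ≠ i0 → j ≠ i0 →
        (if i = j then ε else 0) * (∫ x : Sph d, (x : EuclideanSpace ℝ (Fin d)) i0 ∂μ)
        + ∫ p : Sph d × Sph d, (p.1 : EuclideanSpace ℝ (Fin d)) j *
            (Lq lam i0 i p.1 p.2 * Kker lam p.1 p.2) ∂(μ.prod μ) = 0) →
      ∀ i j, i ≠ i0 → j ≠ i0 →
        |lam i0 * exp (lam i0) * (∫ x : Sph d, (x : EuclideanSpace ℝ (Fin d)) i *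
          (x : EuclideanSpace ℝ (Fin d)) j ∂μ) - (if i = j then ε else 0)|
        ≤ C * ((∫ x, rr i0 x ^ 4 ∂μ) + ε * ∫ x, rr i0 x ^ 2 ∂μ) := by
  obtain ⟨C, hC, hK⟩ := K_est1 lam hpos i0
  set E := exp (lam i0) with hE
  have hE0 : 0 < E := exp_pos _
  refine ⟨lam i0 * (4 * C) + lam i0 * (4 * C) + lam i0 * E * ((4 * C / E) ^ 2 * 4) + 1, by have := hpos i0; positivity, ?_⟩
  intro μ _ ε hε h0 h1 i j hi hj
  have cK := cont_K lam
  have cr := cont_rr i0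
  set M4 := ∫ x, rr i0 x ^ 4 ∂μ with hM4
  set M3 := ∫ x, rr i0 x ^ 3 ∂μ with hM3
  set M2 := ∫ x, rr i0 x ^ 2 ∂μ with hM2
  have hM40 : 0 ≤ M4 := integral_nonneg fun x => by positivity
  have hM20 : 0 ≤ M2 := integral_nonneg fun x => by positivity
  have hM3sq : M3 ^ 2 ≤ 4 * M4 := by
    refine (jensen_sq (by fun_prop) μ).trans ?_
    rw [hM4, ← integral_const_mul]
    refine integral_mono (ci (by fun_prop) _) (ci (by fun_prop) _) fun x => ?_
    have := rr_le i0 x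
    have h' := rr_nonneg i0 x
    have : rr i0 x ^ 2 ≤ 4 := by nlinarith
    nlinarith [mul_nonneg (by positivity : 0 ≤ rr i0 x ^ 4) (sub_nonneg.2 this)]
  -- means
  have hm : ∀ i, i ≠ i0 → |∫ x : Sph d, (x : EuclideanSpace ℝ (Fin d)) i ∂μ| ≤ 4 * C / E * M3 := by
    intro i hi
    have e1 : ∫ p : Sph d × Sph d, Lq lam i0 i p.1 p.2 * Kker lam p.1 p.2 ∂(μ.prod μ)
      = lam i * (∫ p : Sph d × Sph d, (p.1 : EuclideanSpace ℝ (Fin d)) i0 * (p.2 : EuclideanSpace ℝ (Fin d)) i * Kker lam p.1 p.2 ∂(μ.prod μ))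
        - lam i0 * (∫ p : Sph d × Sph d, (p.2 : EuclideanSpace ℝ (Fin d)) i0 * (p.1 : EuclideanSpace ℝ (Fin d)) i * Kker lam p.1 p.2 ∂(μ.prod μ)) := by
      rw [← integral_const_mul, ← integral_const_mul, ← integral_sub (ci (by fun_prop) _) (ci (by fun_prop) _)]
      congr 1; ext p; unfold Lq; ring
    have e2 := int_swap (fun x y : Sph d => (x : EuclideanSpace ℝ (Fin d)) i0 * (y : EuclideanSpace ℝ (Fin d)) i * Kker lam x y) μ
    simp only [fun x y : Sph d => K_symm lam y x] at e2
    have e2' : ∫ p : Sph d × Sph d, (p.1 : EuclideanSpace ℝ (Fin d)) i0 * (p.2 : EuclideanSpace ℝ (Fin d)) i * Kker lam p.1 p.2 ∂(μ.prod μ)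
        = ∫ p : Sph d × Sph d, (p.2 : EuclideanSpace ℝ (Fin d)) i0 * (p.1 : EuclideanSpace ℝ (Fin d)) i * Kker lam p.1 p.2 ∂(μ.prod μ) := by
      have := int_swap (fun x y : Sph d => (x : EuclideanSpace ℝ (Fin d)) i0 * (y : EuclideanSpace ℝ (Fin d)) i * Kker lam x y) μ
      rw [this]
      congr 1; ext p; rw [K_symm lam p.2 p.1]
    rw [h0 i hi, e2', ← sub_mul] at e1
    have e3 : ∫ p : Sph d × Sph d, (p.2 : EuclideanSpace ℝ (Fin d)) i0 * (p.1 : EuclideanSpace ℝ (Fin d)) i * Kker lam p.1 p.2 ∂(μ.prod μ) = 0 := by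
      rcases mul_eq_zero.1 e1.symm with h | h
      · have := hne i hi; linarith
      · exact h
    have e4 := approx_int (F := fun p : Sph d × Sph d => E * (p.1 : EuclideanSpace ℝ (Fin d)) i)
      (H := fun p : Sph d × Sph d => (p.2 : EuclideanSpace ℝ (Fin d)) i0 * (p.1 : EuclideanSpace ℝ (Fin d)) i * Kker lam p.1 p.2)
      (f := fun x => rr i0 x ^ 3) (by fun_prop) (by fun_prop) (by fun_prop) (2 * C) μ (by
        intro p
        have k := (hK p.1 p.2).2.1
        have c := coord_le_rr i0 p.1 hi
        have e : E * (p.1 : EuclideanSpace ℝ (Fin d)) i - (p.2 : EuclideanSpace ℝ (Fin d)) i0 * (p.1 : EuclideanSpace ℝ (Fin d)) i * Kker lam p.1 p.2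
          = -((p.1 : EuclideanSpace ℝ (Fin d)) i * ((p.2 : EuclideanSpace ℝ (Fin d)) i0 * Kker lam p.1 p.2 - E)) := by ring
        rw [e, abs_neg, abs_mul]
        have r0 := rr_nonneg i0 p.1
        have s0 := rr_nonneg i0 p.2
        refine (mul_le_mul c k (abs_nonneg _) r0).trans ?_
        generalize rr i0 p.1 = r at *
        generalize rr i0 p.2 = s at *
        have : r * (r^2 + s^2) ≤ 2 * (r^3 + s^3) := by
          rcases le_total r s with h | h
          · have : r * s ^2 ≤ s * s^2 := mul_le_mul_of_nonneg_right h (sq_nonneg s)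
            nlinarith [pow_nonneg r0 3, pow_nonneg s0 3]
          · have : s^2 ≤ r^2 := by nlinarith
            nlinarith [pow_nonneg r0 3, pow_nonneg s0 3, mul_le_mul_of_nonneg_left this r0]
        have := mul_le_mul_of_nonneg_left this hC.le
        linarith)
    rw [e3, sub_zero, integral_const_mul] at e4
    have e5 : ∫ p : Sph d × Sph d, (p.1 : EuclideanSpace ℝ (Fin d)) i ∂(μ.prod μ) = ∫ x : Sph d, (x : EuclideanSpace ℝ (Fin d)) i ∂μ := by
      have := integral_prod_mul (μ := μ) (ν := μ) (fun x : Sph d => (x : EuclideanSpace ℝ (Fin d)) i) (fun _ => (1:ℝ))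
      simpa using this
    rw [e5, abs_mul, abs_of_pos hE0] at e4
    rw [div_mul_eq_mul_div, le_div_iff₀ hE0]
    linarith
  have hM30 : 0 ≤ M3 := integral_nonneg fun x => pow_nonneg (rr_nonneg _ _) 3
  set mi := ∫ x : Sph d, (x : EuclideanSpace ℝ (Fin d)) i ∂μ with hmi
  set mj := ∫ x : Sph d, (x : EuclideanSpace ℝ (Fin d)) j ∂μ with hmj
  set S := ∫ x : Sph d, (x : EuclideanSpace ℝ (Fin d)) i * (x : EuclideanSpace ℝ (Fin d)) j ∂μ with hSS
  have hmm : |mi * mj| ≤ (4 * C / E) ^ 2 * 4 * M4 := by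
    rw [abs_mul]
    calc _ ≤ (4 * C / E * M3) * (4 * C / E * M3) := mul_le_mul (hm i hi) (hm j hj) (abs_nonneg _) (by positivity)
      _ = (4 * C / E) ^ 2 * M3 ^ 2 := by ring
      _ ≤ (4 * C / E) ^ 2 * (4 * M4) := mul_le_mul_of_nonneg_left hM3sq (by positivity)
      _ = _ := by ring
  -- first approximations
  have f1 := approx_int (F := fun p : Sph d × Sph d => (p.1 : EuclideanSpace ℝ (Fin d)) i * (p.1 : EuclideanSpace ℝ (Fin d)) j * ((p.2 : EuclideanSpace ℝ (Fin d)) i0 * Kker lam p.1 p.2))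
      (H := fun p : Sph d × Sph d => E * ((p.1 : EuclideanSpace ℝ (Fin d)) i * (p.1 : EuclideanSpace ℝ (Fin d)) j))
      (f := fun x => rr i0 x ^ 4) (by fun_prop) (by fun_prop) (by fun_prop) (2 * C) μ (by
        intro p
        have k := (hK p.1 p.2).2.1
        have ci := coord_le_rr i0 p.1 hi
        have cj := coord_le_rr i0 p.1 hj
        have e : (p.1 : EuclideanSpace ℝ (Fin d)) i * (p.1 : EuclideanSpace ℝ (Fin d)) j * ((p.2 : EuclideanSpace ℝ (Fin d)) i0 * Kker lam p.1 p.2) - E * ((p.1 : EuclideanSpace ℝ (Fin d)) i * (p.1 : EuclideanSpace ℝ (Fin d)) j)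
          = ((p.1 : EuclideanSpace ℝ (Fin d)) i * (p.1 : EuclideanSpace ℝ (Fin d)) j) * ((p.2 : EuclideanSpace ℝ (Fin d)) i0 * Kker lam p.1 p.2 - E) := by ring
        rw [e, abs_mul, abs_mul]
        have r0 := rr_nonneg i0 p.1
        refine (mul_le_mul (mul_le_mul ci cj (abs_nonneg _) r0) k (abs_nonneg _) (by positivity)).trans ?_
        simp only
        generalize rr i0 p.1 = r at *
        generalize rr i0 p.2 = s at *
        have : r * r * (r^2 + s^2) ≤ 2 * (r^4 + s^4) := by nlinarith [sq_nonneg (r^2 - s^2), sq_nonneg (r^2), sq_nonneg (s^2)]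
        have := mul_le_mul_of_nonneg_left this hC.le
        linarith)
  have f2 := approx_int (F := fun p : Sph d × Sph d => (p.1 : EuclideanSpace ℝ (Fin d)) j * (p.2 : EuclideanSpace ℝ (Fin d)) i * ((p.1 : EuclideanSpace ℝ (Fin d)) i0 * Kker lam p.1 p.2))
      (H := fun p : Sph d × Sph d => E * ((p.1 : EuclideanSpace ℝ (Fin d)) j * (p.2 : EuclideanSpace ℝ (Fin d)) i))
      (f := fun x => rr i0 x ^ 4) (by fun_prop) (by fun_prop) (by fun_prop) (2 * C) μ (by
        intro p
        have k := (hK p.1 p.2).2.2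
        have ci := coord_le_rr i0 p.2 hi
        have cj := coord_le_rr i0 p.1 hj
        have e : (p.1 : EuclideanSpace ℝ (Fin d)) j * (p.2 : EuclideanSpace ℝ (Fin d)) i * ((p.1 : EuclideanSpace ℝ (Fin d)) i0 * Kker lam p.1 p.2) - E * ((p.1 : EuclideanSpace ℝ (Fin d)) j * (p.2 : EuclideanSpace ℝ (Fin d)) i)
          = ((p.1 : EuclideanSpace ℝ (Fin d)) j * (p.2 : EuclideanSpace ℝ (Fin d)) i) * ((p.1 : EuclideanSpace ℝ (Fin d)) i0 * Kker lam p.1 p.2 - E) := by ring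
        rw [e, abs_mul, abs_mul]
        have r0 := rr_nonneg i0 p.1
        have s0 := rr_nonneg i0 p.2
        refine (mul_le_mul (mul_le_mul cj ci (abs_nonneg _) r0) k (abs_nonneg _) (by positivity)).trans ?_
        simp only
        generalize rr i0 p.1 = r at *
        generalize rr i0 p.2 = s at *
        have : r * s * (r^2 + s^2) ≤ 2 * (r^4 + s^4) := by
          nlinarith [sq_nonneg (r^2 - s^2), sq_nonneg (r^2), sq_nonneg (s^2), mul_nonneg (sq_nonneg (r - s)) (by positivity : 0 ≤ r^2+s^2)]
        have := mul_le_mul_of_nonneg_left this hC.le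
        linarith)
  rw [integral_const_mul] at f1 f2
  have g1 : ∫ p : Sph d × Sph d, (p.1 : EuclideanSpace ℝ (Fin d)) i * (p.1 : EuclideanSpace ℝ (Fin d)) j ∂(μ.prod μ) = S := by
    have := integral_prod_mul (μ := μ) (ν := μ) (fun x : Sph d => (x : EuclideanSpace ℝ (Fin d)) i * (x : EuclideanSpace ℝ (Fin d)) j) (fun _ => (1:ℝ))
    simpa using this
  have g2 : ∫ p : Sph d × Sph d, (p.1 : EuclideanSpace ℝ (Fin d)) j * (p.2 : EuclideanSpace ℝ (Fin d)) i ∂(μ.prod μ) = mi * mj := by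
    rw [integral_prod_mul (μ := μ) (ν := μ) (fun x : Sph d => (x : EuclideanSpace ℝ (Fin d)) j) (fun x : Sph d => (x : EuclideanSpace ℝ (Fin d)) i), mul_comm]
  rw [g1] at f1
  rw [g2] at f2
  have g3 := h1 i j hi hj
  have g4 : ∫ p : Sph d × Sph d, (p.1 : EuclideanSpace ℝ (Fin d)) j * (Lq lam i0 i p.1 p.2 * Kker lam p.1 p.2) ∂(μ.prod μ)
     = lam i * (∫ p : Sph d × Sph d, (p.1 : EuclideanSpace ℝ (Fin d)) j * (p.2 : EuclideanSpace ℝ (Fin d)) i * ((p.1 : EuclideanSpace ℝ (Fin d)) i0 * Kker lam p.1 p.2) ∂(μ.prod μ))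
      - lam i0 * (∫ p : Sph d × Sph d, (p.1 : EuclideanSpace ℝ (Fin d)) i * (p.1 : EuclideanSpace ℝ (Fin d)) j * ((p.2 : EuclideanSpace ℝ (Fin d)) i0 * Kker lam p.1 p.2) ∂(μ.prod μ)) := by
    rw [← integral_const_mul, ← integral_const_mul, ← integral_sub (ci (by fun_prop) _) (ci (by fun_prop) _)]
    congr 1; ext p; unfold Lq; ring
  have g5 : ∫ x : Sph d, (x : EuclideanSpace ℝ (Fin d)) i0 ∂μ = 1 - M2 / 2 := by
    have : ∀ x : Sph d, (x : EuclideanSpace ℝ (Fin d)) i0 = 1 - rr i0 x ^ 2 * (1/2) := fun x => by rw [x0_eq i0]; ring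
    simp_rw [this]
    rw [integral_sub (ci (by fun_prop) _) (ci (by fun_prop) _), integral_mul_const]
    simp; ring
  rw [g4, g5] at g3
  generalize (∫ p : Sph d × Sph d, (p.1 : EuclideanSpace ℝ (Fin d)) j * (p.2 : EuclideanSpace ℝ (Fin d)) i * ((p.1 : EuclideanSpace ℝ (Fin d)) i0 * Kker lam p.1 p.2) ∂(μ.prod μ)) = X at *
  generalize (∫ p : Sph d × Sph d, (p.1 : EuclideanSpace ℝ (Fin d)) i * (p.1 : EuclideanSpace ℝ (Fin d)) j * ((p.2 : EuclideanSpace ℝ (Fin d)) i0 * Kker lam p.1 p.2) ∂(μ.prod μ)) = Y at *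
  generalize hδ : (if i = j then ε else 0) = δ at *
  have hδ' : 0 ≤ δ ∧ δ ≤ ε := by rw [← hδ]; split_ifs <;> constructor <;> linarith
  have e : lam i0 * E * S - δ = -(lam i0 * (Y - E * S)) + lam i * (X - E * (mi * mj)) + lam i * E * (mi * mj) - δ * M2 / 2 := by
    linear_combination (-1) * g3
  rw [e]
  have b1 : |lam i0 * (Y - E * S)| ≤ lam i0 * (4 * C) * M4 := by
    rw [abs_mul, abs_of_pos (hpos i0)]
    have := mul_le_mul_of_nonneg_left f1 (hpos i0).le
    linarith
  have b2 : |lam i * (X - E * (mi * mj))| ≤ lam i0 * (4 * C) * M4 := by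
    rw [abs_mul, abs_of_pos (hpos i)]
    have := mul_le_mul (hne i hi).le f2 (abs_nonneg _) (hpos i0).le
    linarith
  have b3 : |lam i * E * (mi * mj)| ≤ lam i0 * E * ((4 * C / E) ^ 2 * 4) * M4 := by
    rw [abs_mul, abs_of_pos (mul_pos (hpos i) hE0)]
    have := mul_le_mul (mul_le_mul_of_nonneg_right (hne i hi).le hE0.le) hmm (abs_nonneg _) (mul_pos (hpos i0) hE0).le
    linarith
  have b4 : |δ * M2 / 2| ≤ ε * M2 := by
    rw [abs_of_nonneg (by have := mul_nonneg hδ'.1 hM20; linarith)]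
    have := mul_le_mul_of_nonneg_right hδ'.2 hM20
    have := mul_nonneg hδ'.1 hM20
    linarith
  have b5 : |-(lam i0 * (Y - E * S)) + lam i * (X - E * (mi * mj)) + lam i * E * (mi * mj) - δ * M2 / 2|
     ≤ |lam i0 * (Y - E * S)| + |lam i * (X - E * (mi * mj))| + |lam i * E * (mi * mj)| + |δ * M2 / 2| := by
    refine (abs_sub _ _).trans (add_le_add_left ((abs_add_le _ _).trans (add_le_add_left ((abs_add_le _ _).trans ?_) _)) _)
    rw [abs_neg]
  have hC' : 0 ≤ lam i0 * (4 * C) + lam i0 * (4 * C) + lam i0 * E * ((4 * C / E) ^ 2 * 4) := by have := hpos i0; positivity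
  have b6 := mul_nonneg hC' (mul_nonneg hε.le hM20)
  nlinarith


lemma cont_int {X Y : Type*} [TopologicalSpace X] [CompactSpace X] [MeasurableSpace X]
    [OpensMeasurableSpace X] [SecondCountableTopology X] [TopologicalSpace Y]
    [FirstCountableTopology Y] [LocallyCompactSpace Y] (ν : Measure X) [IsFiniteMeasure ν]
    {f : Y → X → ℝ} (hf : Continuous f.uncurry) : Continuous (fun y => ∫ x, f y x ∂ν) := by
  have := continuous_parametric_integral_of_continuous (μ := ν) hf isCompact_univ
  simpa using this

lemma deriv_int {X : Type*} [TopologicalSpace X] [CompactSpace X] [MeasurableSpace X]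
    [OpensMeasurableSpace X] [SecondCountableTopology X] (ν : Measure X) [IsFiniteMeasure ν]
    (f f' : ℝ → X → ℝ) (hf : Continuous f.uncurry) (hf' : Continuous f'.uncurry)
    (hd : ∀ t x, HasDerivAt (fun s => f s x) (f' t x) t) (t : ℝ) :
    HasDerivAt (fun s => ∫ x, f s x ∂ν) (∫ x, f' t x ∂ν) t := by
  obtain ⟨C, hC⟩ := ((isCompact_Icc (a := t - 1) (b := t + 1)).prod (isCompact_univ (X := X))).exists_bound_of_continuousOn
    hf'.continuousOn
  have c1 : ∀ s, Continuous (f s) := fun s => hf.comp (by fun_prop : Continuous fun x => (s, x))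
  have c2 : ∀ s, Continuous (f' s) := fun s => hf'.comp (by fun_prop : Continuous fun x => (s, x))
  refine (hasDerivAt_integral_of_dominated_loc_of_deriv_le (μ := ν) (F := f) (F' := f') (x₀ := t) (s := Set.Icc (t-1) (t+1))
    (bound := fun _ => C) (Icc_mem_nhds (by linarith) (by linarith)) ?_ ?_ ?_ ?_ ?_ ?_).2
  · exact Eventually.of_forall fun s => (c1 s).aestronglyMeasurable
  · exact ci (c1 t) ν
  · exact (c2 t).aestronglyMeasurable
  · exact ae_of_all _ fun x s hs => hC (s, x) ⟨hs, Set.mem_univ _⟩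
  · exact integrable_const C
  · exact ae_of_all _ fun x s _ => hd s x

/-- coefficients of the rotation -/
def ra (i0 i : Fin d) (t : ℝ) (x : EuclideanSpace ℝ (Fin d)) : ℝ := (cos t - 1) * x i0 - sin t * x i
def rb (i0 i : Fin d) (t : ℝ) (x : EuclideanSpace ℝ (Fin d)) : ℝ := sin t * x i0 + (cos t - 1) * x i

def rotL (i0 i : Fin d) (t : ℝ) : EuclideanSpace ℝ (Fin d) →ₗ[ℝ] EuclideanSpace ℝ (Fin d) where
  toFun x := x + ra i0 i t x • EuclideanSpace.single i0 (1:ℝ) + rb i0 i t x • EuclideanSpace.single i (1:ℝ)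
  map_add' x y := by
    ext k; simp [ra, rb]; split_ifs <;> ring
  map_smul' c x := by
    ext k; simp [ra, rb]; split_ifs <;> ring

lemma rotL_apply (i0 i : Fin d) (t : ℝ) (x : EuclideanSpace ℝ (Fin d)) (k : Fin d) :
    (rotL i0 i t x) k = x k + ra i0 i t x * (if k = i0 then 1 else 0) + rb i0 i t x * (if k = i then 1 else 0) := by
  simp [rotL]

lemma rotL_norm (i0 i : Fin d) (hi : i ≠ i0) (t : ℝ) (x : EuclideanSpace ℝ (Fin d)) :
    ‖rotL i0 i t x‖ = ‖x‖ := by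
  have h : ‖rotL i0 i t x‖ ^ 2 = ‖x‖ ^ 2 := by
    rw [EuclideanSpace.real_norm_sq_eq, EuclideanSpace.real_norm_sq_eq]
    have : ∀ k, (rotL i0 i t x) k ^ 2 = x k ^ 2
        + (if k = i0 then ra i0 i t x ^ 2 + 2 * ra i0 i t x * x i0 else 0)
        + (if k = i then rb i0 i t x ^ 2 + 2 * rb i0 i t x * x i else 0) := by
      intro k
      rw [rotL_apply]
      by_cases h1 : k = i0
      · subst h1; simp [Ne.symm hi]; ring
      · by_cases h2 : k = i
        · subst h2; simp [hi]; ring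
        · simp [h1, h2]
    simp_rw [this, Finset.sum_add_distrib]
    simp only [Finset.sum_ite_eq', Finset.mem_univ, if_true]
    unfold ra rb
    linear_combination (x i0 ^ 2 + x i ^ 2) * (sin_sq_add_cos_sq t)
  exact (sq_eq_sq₀ (norm_nonneg _) (norm_nonneg _)).1 h

def rot (i0 i : Fin d) (hi : i ≠ i0) (t : ℝ) : EuclideanSpace ℝ (Fin d) ≃ₗᵢ[ℝ] EuclideanSpace ℝ (Fin d) :=
  LinearIsometry.toLinearIsometryEquiv (⟨rotL i0 i t, rotL_norm i0 i hi t⟩ : EuclideanSpace ℝ (Fin d) →ₗᵢ[ℝ] EuclideanSpace ℝ (Fin d)) rfl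

lemma rot_apply (i0 i : Fin d) (hi : i ≠ i0) (t : ℝ) (x : Sph d) (k : Fin d) :
    (sphMap (rot i0 i hi t) x : EuclideanSpace ℝ (Fin d)) k
      = (x : EuclideanSpace ℝ (Fin d)) k + ra i0 i t x * (if k = i0 then 1 else 0) + rb i0 i t x * (if k = i then 1 else 0) := by
  exact rotL_apply i0 i t x k

lemma cont_sphMap (g : EuclideanSpace ℝ (Fin d) ≃ₗᵢ[ℝ] EuclideanSpace ℝ (Fin d)) : Continuous (sphMap g) := by
  unfold sphMap
  exact Continuous.subtype_mk (g.continuous.comp continuous_subtype_val) _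

lemma qA_rot (lam : Fin d → ℝ) (i0 i : Fin d) (hi : i ≠ i0) (t : ℝ) (x y : Sph d) :
    qA lam (sphMap (rot i0 i hi t) x) y = qA lam x y
      + ra i0 i t x * (lam i0 * (y : EuclideanSpace ℝ (Fin d)) i0) + rb i0 i t x * (lam i * (y : EuclideanSpace ℝ (Fin d)) i) := by
  unfold qA
  simp_rw [rot_apply]
  have : ∀ k, lam k * ((x : EuclideanSpace ℝ (Fin d)) k + ra i0 i t x * (if k = i0 then 1 else 0) + rb i0 i t x * (if k = i then 1 else 0)) * (y : EuclideanSpace ℝ (Fin d)) k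
     = lam k * (x : EuclideanSpace ℝ (Fin d)) k * (y : EuclideanSpace ℝ (Fin d)) k
      + (if k = i0 then ra i0 i t x * (lam i0 * (y : EuclideanSpace ℝ (Fin d)) i0) else 0)
      + (if k = i then rb i0 i t x * (lam i * (y : EuclideanSpace ℝ (Fin d)) i) else 0) := by
    intro k
    by_cases h1 : k = i0
    · subst h1; simp [Ne.symm hi]; ring
    · by_cases h2 : k = i
      · subst h2; simp [hi]; ring
      · simp [h1, h2]
  simp_rw [this, Finset.sum_add_distrib]
  simp

lemma int_rot {ω : Measure (Sph d)} (hω : IsUniform ω) (g : EuclideanSpace ℝ (Fin d) ≃ₗᵢ[ℝ] EuclideanSpace ℝ (Fin d))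
    {F : Sph d → ℝ} (hF : Continuous F) : ∫ x, F (sphMap g x) ∂ω = ∫ x, F x ∂ω := by
  conv_rhs => rw [← hω.2 g]
  rw [integral_map (cont_sphMap g).measurable.aemeasurable hF.aestronglyMeasurable]

lemma cont_W (lam : Fin d → ℝ) (μ : Measure (Sph d)) [IsFiniteMeasure μ] : Continuous (WA lam μ) := by
  unfold WA
  exact cont_int μ (cont_K lam)

set_option maxHeartbeats 1000000 in
/-- integration by parts -/
lemma ibp (lam : Fin d → ℝ) (i0 i j : Fin d) (hi : i ≠ i0) (hj : j ≠ i0) (u v ε : ℝ)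
    {ω : Measure (Sph d)} (hω : IsUniform ω) (μ : Measure (Sph d)) [IsProbabilityMeasure μ] :
    ∫ x : Sph d, (v * (if j = i then 1 else 0) * (x : EuclideanSpace ℝ (Fin d)) i0 +
      (u + v * (x : EuclideanSpace ℝ (Fin d)) j) * ((∫ y, Lq lam i0 i x y * Kker lam x y ∂μ) / ε))
        * exp (WA lam μ x / ε) ∂ω = 0 := by
  have := hω.1
  set ra' : ℝ → Sph d → ℝ := fun t x => -sin t * (x : EuclideanSpace ℝ (Fin d)) i0 - cos t * (x : EuclideanSpace ℝ (Fin d)) i with hra'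
  set rb' : ℝ → Sph d → ℝ := fun t x => cos t * (x : EuclideanSpace ℝ (Fin d)) i0 - sin t * (x : EuclideanSpace ℝ (Fin d)) i with hrb'
  have dra : ∀ t (x : Sph d), HasDerivAt (fun s => ra i0 i s x) (ra' t x) t := by
    intro t x
    unfold ra
    exact (((hasDerivAt_cos t).sub_const 1).mul_const _).sub ((hasDerivAt_sin t).mul_const _)
  have drb : ∀ t (x : Sph d), HasDerivAt (fun s => rb i0 i s x) (rb' t x) t := by
    intro t x
    unfold rb
    have := ((hasDerivAt_sin t).mul_const ((x : EuclideanSpace ℝ (Fin d)) i0)).add (((hasDerivAt_cos t).sub_const 1).mul_const ((x : EuclideanSpace ℝ (Fin d)) i))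
    refine this.congr_deriv ?_
    simp only [hrb']; ring
  have cq : Continuous (fun p : Sph d × Sph d => qA lam p.1 p.2) := cont_qA lam
  set e : ℝ × Sph d → Sph d → ℝ := fun p y => exp (qA lam p.2 y
      + ra i0 i p.1 p.2 * (lam i0 * (y : EuclideanSpace ℝ (Fin d)) i0) + rb i0 i p.1 p.2 * (lam i * (y : EuclideanSpace ℝ (Fin d)) i)) with he
  set e' : ℝ × Sph d → Sph d → ℝ := fun p y => e p y * (ra' p.1 p.2 * (lam i0 * (y : EuclideanSpace ℝ (Fin d)) i0) + rb' p.1 p.2 * (lam i * (y : EuclideanSpace ℝ (Fin d)) i)) with he'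
  have ce : Continuous e.uncurry := by
    have h1 : Continuous (fun q : (ℝ × Sph d) × Sph d => qA lam q.1.2 q.2) := cq.comp (by fun_prop : Continuous (fun q : (ℝ × Sph d) × Sph d => (q.1.2, q.2)))
    simp only [he, Function.uncurry_def, ra, rb]
    fun_prop
  have ce' : Continuous e'.uncurry := by
    have h1 : Continuous (fun q : (ℝ × Sph d) × Sph d => e q.1 q.2) := ce
    simp only [he', Function.uncurry_def, hra', hrb']
    fun_prop
  set w : ℝ × Sph d → ℝ := fun p => ∫ y, e p y ∂μ with hw
  set w' : ℝ × Sph d → ℝ := fun p => ∫ y, e' p y ∂μ with hw'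
  have cw : Continuous w := cont_int μ ce
  have cw' : Continuous w' := cont_int μ ce'
  have de : ∀ s (x y : Sph d), HasDerivAt (fun s => e (s, x) y) (e' (s, x) y) s := by
    intro s x y
    have h1 := (((dra s x).mul_const (lam i0 * (y : EuclideanSpace ℝ (Fin d)) i0)).const_add (qA lam x y)).add
      ((drb s x).mul_const (lam i * (y : EuclideanSpace ℝ (Fin d)) i))
    exact h1.exp
  clear_value e e'
  have dw : ∀ t (x : Sph d), HasDerivAt (fun s => w (s, x)) (w' (t, x)) t := by
    intro t x
    have h1 : Continuous (fun q : ℝ × Sph d => e (q.1, x) q.2) :=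
      ce.comp (by fun_prop : Continuous (fun q : ℝ × Sph d => ((q.1, x), q.2)))
    have h2 : Continuous (fun q : ℝ × Sph d => e' (q.1, x) q.2) :=
      ce'.comp (by fun_prop : Continuous (fun q : ℝ × Sph d => ((q.1, x), q.2)))
    exact deriv_int μ (fun s y => e (s, x) y) (fun s y => e' (s, x) y) h1 h2 (fun s y => de s x y) t
  clear_value w w'
  set f : ℝ → Sph d → ℝ := fun t x => u + v * ((x : EuclideanSpace ℝ (Fin d)) j + rb i0 i t x * (if j = i then 1 else 0)) with hf
  set f' : ℝ → Sph d → ℝ := fun t x => v * (rb' t x * (if j = i then 1 else 0)) with hf'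
  have df : ∀ t (x : Sph d), HasDerivAt (fun s => f s x) (f' t x) t := by
    intro t x
    exact ((((drb t x).mul_const _).const_add _).const_mul v).const_add u
  set G : ℝ → Sph d → ℝ := fun t x => f t x * exp (w (t, x) / ε) with hG
  set G' : ℝ → Sph d → ℝ := fun t x => f' t x * exp (w (t, x) / ε) + f t x * (exp (w (t, x) / ε) * (w' (t, x) / ε)) with hG'
  have cG : Continuous G.uncurry := by
    simp only [hG, Function.uncurry_def, hf, rb]; fun_prop
  have cG' : Continuous G'.uncurry := by
    simp only [hG', Function.uncurry_def, hf, hf', rb, hrb']; fun_prop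
  have dG := deriv_int ω G G' cG cG' (fun t x => (df t x).mul ((dw t x).div_const ε).exp) 0
  have hconst : ∀ t, ∫ x, G t x ∂ω = ∫ x : Sph d, (u + v * (x : EuclideanSpace ℝ (Fin d)) j) * exp (WA lam μ x / ε) ∂ω := by
    intro t
    have cW := cont_W lam μ
    rw [← int_rot hω (rot i0 i hi t) (F := fun x => (u + v * (x : EuclideanSpace ℝ (Fin d)) j) * exp (WA lam μ x / ε)) (by fun_prop)]
    congr 1; ext x
    simp only [hG, hf, rot_apply, if_neg hj, mul_zero, add_zero, hw, he, WA, Kker, qA_rot]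
  simp_rw [hconst] at dG
  have := dG.unique (hasDerivAt_const _ _)
  refine Eq.trans ?_ this
  congr 1; ext x
  have r1 : ra i0 i 0 x = 0 := by simp [ra]
  have r2 : rb i0 i 0 x = 0 := by simp [rb]
  have r3 : w (0, x) = WA lam μ x := by simp [hw, he, r1, r2, WA, Kker]
  have r4 : w' (0, x) = ∫ y, Lq lam i0 i x y * Kker lam x y ∂μ := by
    simp only [hw', he', he, r1, r2, hra', hrb', Lq, Kker]
    congr 1; ext y; simp; ring
  simp only [hG', r3, r4, hf, hf', r2, hrb', cos_zero, sin_zero]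
  ring


/-- monomials -/
def mono' {n : ℕ} (f : Fin n → Fin d) (x : Sph d) : ℝ := ∏ k, (x : EuclideanSpace ℝ (Fin d)) (f k)

lemma cont_mono {n : ℕ} (f : Fin n → Fin d) : Continuous (mono' f) := by
  unfold mono'
  exact continuous_finsetProd _ fun k _ => cont_coord (f k)

def BI (lam : Fin d → ℝ) (μ ν : Measure (Sph d)) : ℝ := ∫ x, WA lam ν x ∂μ

lemma BI_prod (lam : Fin d → ℝ) (μ ν : Measure (Sph d)) [IsProbabilityMeasure μ] [IsProbabilityMeasure ν] :
    BI lam μ ν = ∫ p, Kker lam p.1 p.2 ∂(μ.prod ν) := by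
  unfold BI WA
  rw [integral_prod _ (ci (cont_K lam) _)]

lemma BI_symm (lam : Fin d → ℝ) (μ ν : Measure (Sph d)) [IsProbabilityMeasure μ] [IsProbabilityMeasure ν] :
    BI lam μ ν = BI lam ν μ := by
  rw [BI_prod, BI_prod, ← integral_prod_swap]
  congr 1; ext p; exact K_symm lam _ _

lemma q_pow (lam : Fin d → ℝ) (n : ℕ) (x y : Sph d) :
    (qA lam x y) ^ n = ∑ f : Fin n → Fin d, (∏ k, lam (f k)) * (mono' f x * mono' f y) := by
  unfold qA mono'
  rw [Fintype.sum_pow]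
  refine Finset.sum_congr rfl fun f _ => ?_
  simp only [Finset.prod_mul_distrib]; ring

lemma BI_hasSum (lam : Fin d → ℝ) (hpos : ∀ i, 0 < lam i) (μ ν : Measure (Sph d)) [IsProbabilityMeasure μ] [IsProbabilityMeasure ν] :
    HasSum (fun n : ℕ => (∑ f : Fin n → Fin d, (∏ k, lam (f k)) * ((∫ x, mono' f x ∂μ) * ∫ y, mono' f y ∂ν)) / n.factorial)
      (BI lam μ ν) := by
  rw [BI_prod]
  have key := hasSum_integral_of_dominated_convergence (μ := μ.prod ν)
    (F := fun (n : ℕ) (p : Sph d × Sph d) => (qA lam p.1 p.2) ^ n / n.factorial)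
    (f := fun p => Kker lam p.1 p.2) (fun n _ => (∑ i, lam i) ^ n / n.factorial) ?_ ?_ ?_ ?_ ?_
  · refine key.congr_fun ?_
    intro n
    rw [integral_div]
    congr 1
    simp_rw [q_pow]
    rw [integral_finsetSum _ (fun f _ => ci (by have := cont_mono f; fun_prop) _)]
    refine Finset.sum_congr rfl fun f _ => ?_
    rw [integral_const_mul, integral_prod_mul]
  · intro n
    exact (((cont_qA lam).pow n).div_const _).aestronglyMeasurable
  · intro n
    refine ae_of_all _ fun p => ?_
    rw [norm_div, norm_pow, Real.norm_eq_abs, Real.norm_natCast]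
    gcongr
    exact qA_abs_le lam hpos _ _
  · exact ae_of_all _ fun p => Real.summable_pow_div_factorial _
  · exact integrable_const _
  · refine ae_of_all _ fun p => ?_
    have := NormedSpace.expSeries_div_hasSum_exp (𝔸 := ℝ) (qA lam p.1 p.2)
    rw [← Real.exp_eq_exp_ℝ] at this
    exact this

lemma psd (lam : Fin d → ℝ) (hpos : ∀ i, 0 < lam i) (μ ν : Measure (Sph d)) [IsProbabilityMeasure μ] [IsProbabilityMeasure ν] :
    2 * BI lam μ ν ≤ IA lam μ + IA lam ν := by
  have h := ((BI_hasSum lam hpos μ μ).add (BI_hasSum lam hpos ν ν)).sub ((BI_hasSum lam hpos μ ν).mul_left 2)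
  have h2 := h.nonneg ?_
  · change 0 ≤ IA lam μ + IA lam ν - 2 * BI lam μ ν at h2
    linarith
  intro n
  have e : ∀ A B C N : ℝ, A / N + B / N - 2 * (C / N) = (A + B - 2 * C) / N := fun A B C N => by ring
  rw [e]
  refine div_nonneg ?_ (by positivity)
  rw [Finset.mul_sum, ← Finset.sum_add_distrib, ← Finset.sum_sub_distrib]
  refine Finset.sum_nonneg fun f _ => ?_
  have h1 : 0 ≤ ∏ k, lam (f k) := Finset.prod_nonneg fun k _ => (hpos _).le
  have := mul_nonneg h1 (sq_nonneg ((∫ x, mono' f x ∂μ) - ∫ x, mono' f x ∂ν))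
  linarith

def JJ (lam : Fin d → ℝ) (ω : Measure (Sph d)) (ε : ℝ) (μ : Measure (Sph d)) : ℝ :=
  IA lam μ / 2 - ε * log (∫ x, exp (WA lam μ x / ε) ∂ω)

def gam (lam : Fin d → ℝ) (ω : Measure (Sph d)) (ε : ℝ) (μ : Measure (Sph d)) : Measure (Sph d) :=
  ω.tilted (fun x => WA lam μ x / ε)

lemma tilted_prob (ω : Measure (Sph d)) [IsProbabilityMeasure ω] {f : Sph d → ℝ} (hf : Continuous f) :
    IsProbabilityMeasure (ω.tilted f) :=
  isProbabilityMeasure_tilted (ci (by fun_prop) ω)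

lemma tilted_fin (ω : Measure (Sph d)) [IsProbabilityMeasure ω] {f : Sph d → ℝ} (hf : Continuous f) :
    ω.tilted f ≪ ω ∧ Integrable (fun x => Real.log ((ω.tilted f).rnDeriv ω x).toReal) (ω.tilted f) := by
  have hp := tilted_prob ω hf
  have hac : ω.tilted f ≪ ω := tilted_absolutelyContinuous _ _
  refine ⟨hac, ?_⟩
  have h := hac.ae_eq (log_rnDeriv_tilted_left_self (μ := ω) (f := f) (ci (by fun_prop) ω))
  rw [integrable_congr h]
  exact ci (by fun_prop) _

lemma EA_tilted (lam : Fin d → ℝ) (ω : Measure (Sph d)) [IsProbabilityMeasure ω] (ε : ℝ) {f : Sph d → ℝ} (hf : Continuous f) :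
    EA lam ω ε (ω.tilted f) = ((ε * ((∫ x, f x ∂(ω.tilted f)) - log (∫ x, exp (f x) ∂ω)) - IA lam (ω.tilted f) / 2 : ℝ) : EReal) := by
  have hp := tilted_prob ω hf
  have hc := tilted_fin ω hf
  have h := hc.1.ae_eq (log_rnDeriv_tilted_left_self (μ := ω) (f := f) (ci (by fun_prop) ω))
  unfold EA Ent
  rw [if_pos hc, integral_congr_ae h, integral_sub (ci hf _) (integrable_const _)]
  simp

lemma EA_top (lam : Fin d → ℝ) (ω ν : Measure (Sph d)) (ε : ℝ) (hε : 0 < ε)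
    (h : ¬ (ν ≪ ω ∧ Integrable (fun x => Real.log (ν.rnDeriv ω x).toReal) ν)) : EA lam ω ε ν = ⊤ := by
  unfold EA Ent
  rw [if_neg h, EReal.coe_mul_top_of_pos hε, EReal.top_sub_coe]

/-- Donsker-Varadhan type identity -/
lemma EA_kl (lam : Fin d → ℝ) (ω ν : Measure (Sph d)) [IsProbabilityMeasure ω] [IsProbabilityMeasure ν] (ε : ℝ) (hε : 0 < ε)
    (h : (ν ≪ ω ∧ Integrable (fun x => Real.log (ν.rnDeriv ω x).toReal) ν)) :
    EA lam ω ε ν = ((JJ lam ω ε ν + ε * (InformationTheory.klDiv ν (gam lam ω ε ν)).toReal : ℝ) : EReal)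
    ∧ InformationTheory.klDiv ν (gam lam ω ε ν) ≠ ⊤ := by
  have cW := cont_W lam ν
  have cf : Continuous (fun x => WA lam ν x / ε) := by fun_prop
  have hp := tilted_prob ω cf
  have hac : ν ≪ gam lam ω ε ν := h.1.trans (absolutelyContinuous_tilted (ci (by fun_prop) ω))
  constructor
  · have hp' : IsProbabilityMeasure (gam lam ω ε ν) := hp
    have h1 := integral_llr_tilted_right h.1 (ci cf ν) (ci (by fun_prop) ω) h.2
    rw [InformationTheory.toReal_klDiv_of_measure_eq hac (by simp)]
    unfold gam
    rw [h1]
    unfold EA Ent JJ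
    rw [if_pos h, integral_div]
    rw [← EReal.coe_mul, ← EReal.coe_sub]
    congr 1
    change _ = _ + ε * ((∫ x, Real.log (ν.rnDeriv ω x).toReal ∂ν) - IA lam ν / ε + _)
    field_simp
    ring
  · exact InformationTheory.klDiv_ne_top hac (integrable_llr_tilted_right h.1 (ci cf ν) h.2 (ci (by fun_prop) ω))

lemma J_le_E (lam : Fin d → ℝ) (ω ν : Measure (Sph d)) [IsProbabilityMeasure ω] [IsProbabilityMeasure ν] (ε : ℝ) (hε : 0 < ε) :
    (JJ lam ω ε ν : EReal) ≤ EA lam ω ε ν := by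
  by_cases h : (ν ≪ ω ∧ Integrable (fun x => Real.log (ν.rnDeriv ω x).toReal) ν)
  · rw [(EA_kl lam ω ν ε hε h).1, EReal.coe_le_coe_iff]
    have : 0 ≤ ε * (InformationTheory.klDiv ν (gam lam ω ε ν)).toReal := mul_nonneg hε.le ENNReal.toReal_nonneg
    linarith
  · rw [EA_top lam ω ν ε hε h]; exact le_top

lemma gibbs_of_le (lam : Fin d → ℝ) (ω ν : Measure (Sph d)) [IsProbabilityMeasure ω] [IsProbabilityMeasure ν] (ε : ℝ) (hε : 0 < ε)
    (hle : EA lam ω ε ν ≤ (JJ lam ω ε ν : EReal)) : ν = gam lam ω ε ν := by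
  by_cases h : (ν ≪ ω ∧ Integrable (fun x => Real.log (ν.rnDeriv ω x).toReal) ν)
  · have hk := EA_kl lam ω ν ε hε h
    rw [hk.1, EReal.coe_le_coe_iff] at hle
    have h0 : (InformationTheory.klDiv ν (gam lam ω ε ν)).toReal = 0 := by
      have := @ENNReal.toReal_nonneg (InformationTheory.klDiv ν (gam lam ω ε ν))
      nlinarith
    have cW := cont_W lam ν
    have hp' : IsProbabilityMeasure (gam lam ω ε ν) := tilted_prob ω (by fun_prop)
    rw [ENNReal.toReal_eq_zero_iff] at h0
    exact InformationTheory.klDiv_eq_zero_iff.1 (h0.resolve_right hk.2)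
  · rw [EA_top lam ω ν ε hε h] at hle
    simp at hle

lemma E_gam_le (lam : Fin d → ℝ) (hpos : ∀ i, 0 < lam i) (ω ν : Measure (Sph d)) [IsProbabilityMeasure ω] [IsProbabilityMeasure ν] (ε : ℝ) (hε : 0 < ε) :
    EA lam ω ε (gam lam ω ε ν) ≤ (JJ lam ω ε ν : EReal) := by
  have cW := cont_W lam ν
  have cf : Continuous (fun x => WA lam ν x / ε) := by fun_prop
  have hp' : IsProbabilityMeasure (gam lam ω ε ν) := tilted_prob ω (by fun_prop)
  have h1 := psd lam hpos (gam lam ω ε ν) ν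
  have h2 := EA_tilted lam ω ε cf
  rw [integral_div] at h2
  unfold gam at *
  rw [h2, EReal.coe_le_coe_iff]
  unfold JJ
  unfold BI at h1
  rw [mul_sub, mul_div_cancel₀ _ hε.ne']
  linarith

/-- consequences of being a minimizer -/
lemma minimizer_props (lam : Fin d → ℝ) (hpos : ∀ i, 0 < lam i) (ω μ : Measure (Sph d)) [IsProbabilityMeasure ω] (ε : ℝ) (hε : 0 < ε)
    (hμ : IsMinimizer lam ω ε μ) : μ = gam lam ω ε μ ∧ (∀ ν : Measure (Sph d), IsProbabilityMeasure ν → JJ lam ω ε μ ≤ JJ lam ω ε ν) := by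
  have := hμ.1
  have key : ∀ ν : Measure (Sph d), IsProbabilityMeasure ν → EA lam ω ε μ ≤ (JJ lam ω ε ν : EReal) := by
    intro ν hν
    have cW := cont_W lam ν
    exact (hμ.2 _ (tilted_prob ω (by fun_prop))).trans (E_gam_le lam hpos ω ν ε hε)
  refine ⟨gibbs_of_le lam ω μ ε hε (key μ hμ.1), fun ν hν => ?_⟩
  exact EReal.coe_le_coe_iff.1 ((J_le_E lam ω μ ε hε).trans (key ν hν))

lemma minimizer_of (lam : Fin d → ℝ) (hpos : ∀ i, 0 < lam i) (ω μ : Measure (Sph d)) [IsProbabilityMeasure ω] [IsProbabilityMeasure μ] (ε : ℝ) (hε : 0 < ε)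
    (h : ∀ ν : Measure (Sph d), IsProbabilityMeasure ν → JJ lam ω ε μ ≤ JJ lam ω ε ν) : IsMinimizer lam ω ε (gam lam ω ε μ) := by
  have cW := cont_W lam μ
  refine ⟨tilted_prob ω (by fun_prop), fun ν hν => ?_⟩
  exact (E_gam_le lam hpos ω μ ε hε).trans ((EReal.coe_le_coe_iff.2 (h ν hν)).trans (J_le_E lam ω ν ε hε))

lemma exists_minimizer (lam : Fin d → ℝ) (hpos : ∀ i, 0 < lam i) (ω : Measure (Sph d)) [IsProbabilityMeasure ω] (ε : ℝ) (hε : 0 < ε) :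
    ∃ μ, IsMinimizer lam ω ε μ := by
  have hcomp : Continuous (fun μ : ProbabilityMeasure (Sph d) => JJ lam ω ε μ) := by
    have h1 : Continuous (fun μ : ProbabilityMeasure (Sph d) => IA lam μ) := by
      have h2 : ∀ μ : ProbabilityMeasure (Sph d), IA lam μ = ∫ p, Kker lam p.1 p.2 ∂((μ.prod μ : ProbabilityMeasure (Sph d × Sph d)) : Measure (Sph d × Sph d)) := by
        intro μ
        exact BI_prod lam μ μ
      simp_rw [h2]
      have h3 : Continuous (fun μ : ProbabilityMeasure (Sph d) => μ.prod μ) :=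
        ProbabilityMeasure.continuous_prod.comp (by fun_prop : Continuous fun μ : ProbabilityMeasure (Sph d) => (μ, μ))
      exact (ProbabilityMeasure.continuous_integral_boundedContinuousFunction
        (BoundedContinuousFunction.mkOfCompact ⟨fun p : Sph d × Sph d => Kker lam p.1 p.2, cont_K lam⟩)).comp h3
    have h4 : ∀ x, Continuous (fun μ : ProbabilityMeasure (Sph d) => WA lam μ x) := by
      intro x
      have cKx : Continuous (fun y => Kker lam x y) := (cont_K lam).comp (by fun_prop : Continuous fun y : Sph d => (x, y))
      exact ProbabilityMeasure.continuous_integral_boundedContinuousFunction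
        (BoundedContinuousFunction.mkOfCompact ⟨fun y : Sph d => Kker lam x y, cKx⟩)
    have hWle : ∀ (μ : ProbabilityMeasure (Sph d)) x, WA lam μ x ≤ exp (∑ i, lam i) := by
      intro μ x
      have cKx : Continuous (fun y => Kker lam x y) := (cont_K lam).comp (by fun_prop : Continuous fun y : Sph d => (x, y))
      unfold WA
      have : ∫ y, Kker lam x y ∂(μ : Measure (Sph d)) ≤ ∫ y, exp (∑ i, lam i) ∂(μ : Measure (Sph d)) :=
        integral_mono (ci cKx _) (integrable_const _) fun y => exp_le_exp.2 ((le_abs_self _).trans (qA_abs_le lam hpos x y))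
      simpa using this
    have h5 : Continuous (fun μ : ProbabilityMeasure (Sph d) => ∫ x, exp (WA lam μ x / ε) ∂ω) := by
      refine continuous_of_dominated (bound := fun _ => exp (exp (∑ i, lam i) / ε)) ?_ ?_ ?_ ?_
      · intro μ
        have cW := cont_W lam (μ : Measure (Sph d))
        exact (by fun_prop : Continuous fun x => exp (WA lam μ x / ε)).aestronglyMeasurable
      · intro μ
        refine ae_of_all _ fun x => ?_
        rw [Real.norm_eq_abs, abs_exp]
        have := hWle μ x
        gcongr
      · exact integrable_const _
      · refine ae_of_all _ fun x => ?_
        have := h4 x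
        fun_prop
    unfold JJ
    refine (h1.div_const 2).sub (Continuous.mul continuous_const (h5.log fun μ => ?_))
    have cW := cont_W lam (μ : Measure (Sph d))
    exact (integral_exp_pos (ci (by fun_prop) ω)).ne'
  have : Nonempty (ProbabilityMeasure (Sph d)) := ⟨⟨ω, inferInstance⟩⟩
  obtain ⟨μ, -, hμ⟩ := isCompact_univ.exists_isMinOn Set.univ_nonempty hcomp.continuousOn
  exact ⟨_, minimizer_of lam hpos ω μ ε hε fun ν hν => hμ (Set.mem_univ (⟨ν, hν⟩ : ProbabilityMeasure (Sph d)))⟩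


lemma antip_eq (x : Sph d) : antip x = sphMap (LinearIsometryEquiv.neg ℝ) x := by
  apply Subtype.ext; simp [antip, sphMap]

lemma antip_fun : (antip : Sph d → Sph d) = sphMap (LinearIsometryEquiv.neg ℝ) := funext antip_eq

lemma cont_antip : Continuous (antip : Sph d → Sph d) := by rw [antip_fun]; exact cont_sphMap _

lemma antip_coord (x : Sph d) (i : Fin d) : (antip x : EuclideanSpace ℝ (Fin d)) i = -(x : EuclideanSpace ℝ (Fin d)) i := by
  simp [antip]

lemma antip_antip (x : Sph d) : antip (antip x) = x := by
  apply Subtype.ext; simp [antip]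

lemma K_antip (lam : Fin d → ℝ) (x y : Sph d) : Kker lam x (antip y) = Kker lam (antip x) y := by
  unfold Kker qA
  simp [antip_coord]

lemma int_antip (μ : Measure (Sph d)) {f : Sph d → ℝ} (hf : Continuous f) :
    ∫ x, f x ∂(Measure.map antip μ) = ∫ x, f (antip x) ∂μ :=
  integral_map cont_antip.measurable.aemeasurable hf.aestronglyMeasurable

lemma cont_Kx (lam : Fin d → ℝ) (x : Sph d) : Continuous (fun y => Kker lam x y) :=
  (cont_K lam).comp (by fun_prop : Continuous fun y : Sph d => (x, y))

lemma W_antip (lam : Fin d → ℝ) (μ : Measure (Sph d)) (x : Sph d) :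
    WA lam (Measure.map antip μ) x = WA lam μ (antip x) := by
  unfold WA
  rw [int_antip μ (cont_Kx lam x)]
  simp_rw [K_antip]

lemma map_antip_prob (μ : Measure (Sph d)) [IsProbabilityMeasure μ] : IsProbabilityMeasure (Measure.map antip μ) :=
  Measure.isProbabilityMeasure_map cont_antip.measurable.aemeasurable

lemma IA_antip (lam : Fin d → ℝ) (μ : Measure (Sph d)) [IsProbabilityMeasure μ] :
    IA lam (Measure.map antip μ) = IA lam μ := by
  have := map_antip_prob μ
  change ∫ x, WA lam (Measure.map antip μ) x ∂(Measure.map antip μ) = ∫ x, WA lam μ x ∂μ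
  rw [int_antip μ (cont_W lam _)]
  simp_rw [W_antip, antip_antip]

lemma omega_antip {ω : Measure (Sph d)} (hω : IsUniform ω) : Measure.map antip ω = ω := by
  rw [antip_fun]; exact hω.2 _

lemma Z_antip (lam : Fin d → ℝ) {ω : Measure (Sph d)} (hω : IsUniform ω) (ε : ℝ) (μ : Measure (Sph d)) [IsProbabilityMeasure μ] :
    ∫ x, exp (WA lam (Measure.map antip μ) x / ε) ∂ω = ∫ x, exp (WA lam μ x / ε) ∂ω := by
  have cW := cont_W lam μ
  conv_rhs => rw [← omega_antip hω]
  rw [int_antip ω (by fun_prop)]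
  simp_rw [W_antip]

lemma gam_antip (lam : Fin d → ℝ) {ω : Measure (Sph d)} (hω : IsUniform ω) (ε : ℝ) (μ : Measure (Sph d)) [IsProbabilityMeasure μ] :
    gam lam ω ε (Measure.map antip μ) = Measure.map antip (gam lam ω ε μ) := by
  have cW := cont_W lam μ
  ext s hs
  have m := (cont_antip (d := d)).measurable
  rw [Measure.map_apply m hs]
  unfold gam
  rw [tilted_apply' _ _ hs, tilted_apply' _ _ (m hs), Z_antip lam hω]
  simp_rw [W_antip]
  have m2 : Measurable (fun a => ENNReal.ofReal (exp (WA lam μ (antip a) / ε) / ∫ x, exp (WA lam μ x / ε) ∂ω)) := by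
    have : Continuous (fun a => exp (WA lam μ (antip a) / ε) / ∫ x, exp (WA lam μ x / ε) ∂ω) := by
      have := cont_antip (d := d)
      fun_prop
    exact this.measurable.ennreal_ofReal
  conv_lhs => rw [← omega_antip hω]
  rw [omega_antip hω]
  conv_lhs => 
    arg 1
    rw [← omega_antip hω]
  rw [setLIntegral_map hs m2 m]
  simp_rw [antip_antip]

lemma minimizer_antip (lam : Fin d → ℝ) (hpos : ∀ i, 0 < lam i) {ω : Measure (Sph d)} (hω : IsUniform ω) (μ : Measure (Sph d)) (ε : ℝ) (hε : 0 < ε)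
    (hμ : IsMinimizer lam ω ε μ) : IsMinimizer lam ω ε (Measure.map antip μ) := by
  have := hω.1
  have := hμ.1
  have := map_antip_prob μ
  obtain ⟨h1, h2⟩ := minimizer_props lam hpos ω μ ε hε hμ
  have h3 : JJ lam ω ε (Measure.map antip μ) = JJ lam ω ε μ := by
    unfold JJ; rw [IA_antip, Z_antip lam hω]
  have h4 := minimizer_of lam hpos ω (Measure.map antip μ) ε hε (by rw [h3]; exact h2)
  rwa [gam_antip lam hω, ← h1] at h4

/-- pole -/
def pole (i0 : Fin d) : Sph d := ⟨EuclideanSpace.single i0 1, by simp⟩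

lemma pole_coord (i0 i : Fin d) : (pole i0 : EuclideanSpace ℝ (Fin d)) i = if i = i0 then 1 else 0 := by
  simp [pole]

lemma open_pos {ω : Measure (Sph d)} (hω : IsUniform ω) {U : Set (Sph d)} (hU : IsOpen U) (e : Sph d) (he : e ∈ U) :
    ω U ≠ 0 := by
  intro h0
  have := hω.1
  have : ω Set.univ = 0 := by
    refine measure_null_of_locally_null _ fun z _ => ?_
    set g : EuclideanSpace ℝ (Fin d) ≃ₗᵢ[ℝ] EuclideanSpace ℝ (Fin d) :=
      (Submodule.span ℝ {(z : EuclideanSpace ℝ (Fin d)) - e})ᗮ.reflection with hg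
    have hgz : sphMap g z = e := by
      apply Subtype.ext
      have h1 : ‖(z : EuclideanSpace ℝ (Fin d))‖ = 1 := mem_sphere_zero_iff_norm.1 z.2
      have h2 : ‖(e : EuclideanSpace ℝ (Fin d))‖ = 1 := mem_sphere_zero_iff_norm.1 e.2
      exact Submodule.reflection_sub (h1.trans h2.symm)
    refine ⟨sphMap g ⁻¹' U, ?_, ?_⟩
    · rw [nhdsWithin_univ]
      exact (hU.preimage (cont_sphMap g)).mem_nhds (by simpa [hgz] using he)
    · rw [← Measure.map_apply (cont_sphMap g).measurable hU.measurableSet, hω.2 g, h0]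
  simp at this

def cap (i0 : Fin d) (δ : ℝ) : Set (Sph d) := {x | rr i0 x ^ 2 < δ}

lemma cap_open (i0 : Fin d) (δ : ℝ) : IsOpen (cap i0 δ) :=
  isOpen_lt ((cont_rr i0).pow 2) continuous_const

lemma rr_pole (i0 : Fin d) : rr i0 (pole i0) ^ 2 = 0 := by rw [rr_sq, pole_coord]; simp

lemma cap_pos {ω : Measure (Sph d)} (hω : IsUniform ω) (i0 : Fin d) {δ : ℝ} (hδ : 0 < δ) : 0 < ω.real (cap i0 δ) := by
  have := hω.1
  have h := open_pos hω (cap_open i0 δ) (pole i0) (by simp only [cap, Set.mem_ofPred_eq, rr_pole]; exact hδ)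
  exact ENNReal.toReal_pos h (measure_ne_top _ _)

lemma Z_lower (i0 : Fin d) {ω : Measure (Sph d)} [IsProbabilityMeasure ω] {f : Sph d → ℝ} (hf : Continuous f) (δ c : ℝ)
    (h : ∀ x, rr i0 x ^ 2 < δ → c ≤ f x) : ω.real (cap i0 δ) * exp c ≤ ∫ x, exp (f x) ∂ω := by
  have h1 : ∫ x, (cap i0 δ).indicator (fun _ => exp c) x ∂ω = ω.real (cap i0 δ) * exp c := by
    rw [integral_indicator (cap_open i0 δ).measurableSet]
    simp
  rw [← h1]
  refine integral_mono ((integrable_const _).indicator (cap_open i0 δ).measurableSet) (ci (by fun_prop) ω) fun x => ?_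
  by_cases hx : x ∈ cap i0 δ
  · rw [Set.indicator_of_mem hx]; exact exp_le_exp.2 (h x hx)
  · rw [Set.indicator_of_notMem hx]; positivity

lemma qA_le (lam : Fin d → ℝ) (hpos : ∀ i, 0 < lam i) (i0 : Fin d) (hle : ∀ i, lam i ≤ lam i0) (x y : Sph d) :
    qA lam x y ≤ lam i0 := by
  unfold qA
  have h1 : ∀ i, lam i * (x : EuclideanSpace ℝ (Fin d)) i * (y : EuclideanSpace ℝ (Fin d)) i ≤
      lam i0 / 2 * ((x : EuclideanSpace ℝ (Fin d)) i ^ 2 + (y : EuclideanSpace ℝ (Fin d)) i ^ 2) := by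
    intro i
    have a1 := two_mul_le_add_sq ((x : EuclideanSpace ℝ (Fin d)) i) ((y : EuclideanSpace ℝ (Fin d)) i)
    have a2 := mul_le_mul_of_nonneg_left a1 (hpos i).le
    have a3 := mul_le_mul_of_nonneg_right (hle i) (by positivity : 0 ≤ (x : EuclideanSpace ℝ (Fin d)) i ^ 2 + (y : EuclideanSpace ℝ (Fin d)) i ^ 2)
    linarith
  refine (Finset.sum_le_sum fun i _ => h1 i).trans ?_
  rw [← Finset.mul_sum, Finset.sum_add_distrib, sum_sq, sum_sq]
  linarith

lemma ent_nonneg (lam : Fin d → ℝ) (ω μ : Measure (Sph d)) [IsProbabilityMeasure ω] [IsProbabilityMeasure μ] (ε : ℝ) (hε : 0 < ε)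
    (h : μ = gam lam ω ε μ) : - IA lam μ / 2 ≤ JJ lam ω ε μ := by
  have cW := cont_W lam μ
  have cf : Continuous (fun x => WA lam μ x / ε) := by fun_prop
  have hc := tilted_fin ω cf
  have hp := tilted_prob ω cf
  have h1 := hc.1.ae_eq (log_rnDeriv_tilted_left_self (μ := ω) (f := (fun x => WA lam μ x / ε)) (ci (by fun_prop) ω))
  have h2 := InformationTheory.toReal_klDiv_of_measure_eq hc.1 (by simp)
  have h3 : ∫ a, llr (ω.tilted fun x => WA lam μ x / ε) ω a ∂(ω.tilted fun x => WA lam μ x / ε) = _ := integral_congr_ae h1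
  rw [h3, integral_sub (ci cf _) (integrable_const _)] at h2
  have h4 : (ω.tilted fun x => WA lam μ x / ε) = μ := h.symm
  rw [h4, integral_div] at h2
  have h5 : 0 ≤ (∫ x, WA lam μ x ∂μ) / ε - log (∫ x, exp (WA lam μ x / ε) ∂ω) := by
    have := @ENNReal.toReal_nonneg (InformationTheory.klDiv μ ω)
    rw [h2] at this
    simpa using this
  have h6 := mul_nonneg hε.le h5
  rw [mul_sub, mul_div_cancel₀ _ hε.ne'] at h6
  unfold JJ
  change 0 ≤ IA lam μ - _ at h6
  linarith

lemma W_pole (lam : Fin d → ℝ) (i0 : Fin d) (x : Sph d) : WA lam (Measure.dirac (pole i0)) x = exp (lam i0 * (1 - rr i0 x ^ 2 / 2)) := by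
  unfold WA
  rw [integral_dirac, ← x0_eq]
  unfold Kker qA
  congr 1
  rw [Finset.sum_eq_single i0]
  · simp [pole_coord]
  · intro i _ hi; simp [pole_coord, hi]
  · simp

lemma conc1 (lam : Fin d → ℝ) (hpos : ∀ i, 0 < lam i) (i0 : Fin d) {ω : Measure (Sph d)} (hω : IsUniform ω) (η : ℝ) (hη : 0 < η) :
    ∃ ε₀ > 0, ∀ ε, 0 < ε → ε < ε₀ → ∀ μ, IsMinimizer lam ω ε μ → exp (lam i0) - η ≤ IA lam μ := by
  have := hω.1
  -- cap on which exp is close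
  have hcont : Continuous (fun t : ℝ => exp (lam i0 * (1 - t / 2))) := by fun_prop
  have h0 := hcont.tendsto 0
  simp only [zero_div, sub_zero, mul_one] at h0
  obtain ⟨δ, hδ, hδ'⟩ := Metric.tendsto_nhds_nhds.1 h0 (η / 4) (by linarith)
  set c := ω.real (cap i0 δ) with hc
  have hcp : 0 < c := cap_pos hω i0 hδ
  refine ⟨η / (4 * (|log c| + 1)), by positivity, fun ε hε hε' μ hμ => ?_⟩
  have := hμ.1
  obtain ⟨h1, h2⟩ := minimizer_props lam hpos ω μ ε hε hμ
  have h3 := h2 (Measure.dirac (pole i0)) inferInstance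
  have h4 := ent_nonneg lam ω μ ε hε h1
  have cW := cont_W lam (Measure.dirac (pole i0))
  have hZ := Z_lower i0 (ω := ω) (f := fun x => WA lam (Measure.dirac (pole i0)) x / ε) (by fun_prop) δ ((exp (lam i0) - η / 4) / ε) (by
    intro x hx
    have := hδ' (x := rr i0 x ^ 2) (by rw [Real.dist_eq, sub_zero, abs_of_nonneg (sq_nonneg _)]; exact hx)
    rw [Real.dist_eq, abs_lt] at this
    simp only [W_pole]
    gcongr
    linarith)
  have hZ2 := log_le_log (by positivity) hZ
  rw [← hc, log_mul hcp.ne' (exp_pos _).ne', log_exp] at hZ2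
  have hZ3 := mul_le_mul_of_nonneg_left hZ2 hε.le
  rw [mul_add, mul_div_cancel₀ _ hε.ne'] at hZ3
  have hI : IA lam (Measure.dirac (pole i0)) = exp (lam i0) := by
    change ∫ x, WA lam (Measure.dirac (pole i0)) x ∂(Measure.dirac (pole i0)) = _
    rw [integral_dirac, W_pole, rr_pole]; simp
  have h5 : JJ lam ω ε (Measure.dirac (pole i0)) ≤ - exp (lam i0) / 2 + η / 4 - ε * log c := by
    unfold JJ; rw [hI]; linarith
  have h6 : - (ε * log c) ≤ η / 4 := by
    have a1 : ε * (4 * (|log c| + 1)) < η := (lt_div_iff₀ (by positivity)).1 hε'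
    have a2 := neg_abs_le (log c)
    nlinarith
  linarith

lemma conc (lam : Fin d → ℝ) (hpos : ∀ i, 0 < lam i) (i0 : Fin d) (l2 : ℝ) (hl20 : 0 ≤ l2) (hl2 : ∀ i, i ≠ i0 → lam i ≤ l2) (hl : l2 < lam i0)
    {ω : Measure (Sph d)} (hω : IsUniform ω) (η : ℝ) (hη : 0 < η) :
    ∃ ε₀ > 0, ∀ ε, 0 < ε → ε < ε₀ → ∀ μ, IsMinimizer lam ω ε μ →
      1 - (∫ x : Sph d, (x : EuclideanSpace ℝ (Fin d)) i0 ∂μ) ^ 2 ≤ η := by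
  set Λ := ∑ i, lam i with hΛ
  have hle : ∀ i, lam i ≤ lam i0 := fun i => by
    by_cases h : i = i0
    · rw [h]
    · exact (hl2 i h).trans hl.le
  obtain ⟨ε₀, h0, H⟩ := conc1 lam hpos i0 hω (η * (exp (-Λ) * (lam i0 - l2))) (mul_pos hη (mul_pos (exp_pos _) (by linarith)))
  refine ⟨ε₀, h0, fun ε hε hε' μ hμ => ?_⟩
  have := hμ.1
  have h1 := H ε hε hε' μ hμ
  have hpt : ∀ x y : Sph d, Kker lam x y ≤ exp (lam i0) - exp (-Λ) * (lam i0 - qA lam x y) := by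
    intro x y
    have a1 : exp (qA lam x y) * (1 + (lam i0 - qA lam x y)) ≤ exp (lam i0) := by
      have : exp (lam i0) = exp (qA lam x y) * exp (lam i0 - qA lam x y) := by rw [← exp_add]; congr 1; ring
      rw [this]
      have := add_one_le_exp (lam i0 - qA lam x y)
      gcongr
      linarith
    have a2 : exp (-Λ) ≤ exp (qA lam x y) := exp_le_exp.2 (abs_le.1 (qA_abs_le lam hpos x y)).1
    have a3 := qA_le lam hpos i0 hle x y
    have a4 := mul_le_mul_of_nonneg_right a2 (sub_nonneg.2 a3)
    unfold Kker
    linarith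
  have h2 : IA lam μ ≤ exp (lam i0) - exp (-Λ) * (lam i0 - ∫ p : Sph d × Sph d, qA lam p.1 p.2 ∂(μ.prod μ)) := by
    have b1 : IA lam μ = ∫ p, Kker lam p.1 p.2 ∂(μ.prod μ) := BI_prod lam μ μ
    have cq := cont_qA lam
    rw [b1]
    refine (integral_mono (ci (cont_K lam) _) (ci (by fun_prop) _) fun p => hpt p.1 p.2).trans (le_of_eq ?_)
    rw [integral_sub (integrable_const _) (ci (by fun_prop) _), integral_const_mul, integral_sub (integrable_const _) (ci cq _)]
    simp
  have h3 : ∫ p : Sph d × Sph d, qA lam p.1 p.2 ∂(μ.prod μ) = ∑ i, lam i * (∫ x : Sph d, (x : EuclideanSpace ℝ (Fin d)) i ∂μ) ^ 2 := by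
    unfold qA
    have cc := cont_coord (d := d)
    rw [integral_finsetSum _ (fun i _ => ci (by fun_prop) _)]
    refine Finset.sum_congr rfl fun i _ => ?_
    simp_rw [mul_assoc]
    rw [integral_const_mul, integral_prod_mul (fun x : Sph d => (x : EuclideanSpace ℝ (Fin d)) i) (fun x : Sph d => (x : EuclideanSpace ℝ (Fin d)) i)]
    ring
  have h4 : ∑ i, (∫ x : Sph d, (x : EuclideanSpace ℝ (Fin d)) i ∂μ) ^ 2 ≤ 1 := by
    refine (Finset.sum_le_sum fun i _ => jensen_sq (cont_coord i) μ).trans ?_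
    have cc := cont_coord (d := d)
    rw [← integral_finsetSum _ (fun i _ => ci (by fun_prop) _)]
    simp_rw [sum_sq]
    simp
  set m : Fin d → ℝ := fun i => ∫ x : Sph d, (x : EuclideanSpace ℝ (Fin d)) i ∂μ with hm
  have h5 : ∑ i, lam i * m i ^ 2 ≤ (lam i0 - l2) * m i0 ^ 2 + l2 * ∑ i, m i ^ 2 := by
    rw [← Finset.add_sum_erase _ _ (Finset.mem_univ i0), ← Finset.add_sum_erase _ (fun i => m i ^ 2) (Finset.mem_univ i0), mul_add, Finset.mul_sum]
    have : ∑ i ∈ Finset.univ.erase i0, lam i * m i ^ 2 ≤ ∑ i ∈ Finset.univ.erase i0, l2 * m i ^ 2 := by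
      refine Finset.sum_le_sum fun i hi => ?_
      have := hl2 i (Finset.ne_of_mem_erase hi)
      gcongr
    linarith
  rw [h3] at h2
  have h6 := mul_le_mul_of_nonneg_left h4 hl20
  have h7 : (lam i0 - l2) * (1 - m i0 ^ 2) ≤ lam i0 - ∑ i, lam i * m i ^ 2 := by linarith
  have h8 := mul_le_mul_of_nonneg_left h7 (exp_pos (-Λ)).le
  have h9 : (exp (-Λ) * (lam i0 - l2)) * (1 - m i0 ^ 2) ≤ (exp (-Λ) * (lam i0 - l2)) * η := by
    change IA lam μ ≤ exp (lam i0) - exp (-Λ) * (lam i0 - ∑ i, lam i * m i ^ 2) at h2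
    linarith
  exact le_of_mul_le_mul_left h9 (mul_pos (exp_pos _) (by linarith))


lemma gibbs_int (lam : Fin d → ℝ) (ω μ : Measure (Sph d)) (ε : ℝ) (h : μ = gam lam ω ε μ) (g : Sph d → ℝ) :
    ∫ x, g x ∂μ = (∫ x, g x * exp (WA lam μ x / ε) ∂ω) / (∫ x, exp (WA lam μ x / ε) ∂ω) := by
  conv_lhs => rw [h]
  unfold gam
  rw [integral_tilted, ← integral_div]
  congr 1; ext x
  rw [smul_eq_mul]; ring

lemma gibbs_moments (lam : Fin d → ℝ) (i0 : Fin d) {ω : Measure (Sph d)} (hω : IsUniform ω) (μ : Measure (Sph d)) [IsProbabilityMeasure μ]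
    (ε : ℝ) (hε : 0 < ε) (h : μ = gam lam ω ε μ) :
    (∀ i : Fin d, i ≠ i0 → ∫ p : Sph d × Sph d, Lq lam i0 i p.1 p.2 * Kker lam p.1 p.2 ∂μ.prod μ = 0) ∧
    (∀ i j : Fin d, i ≠ i0 → j ≠ i0 → (if i = j then ε else 0) * ∫ x : Sph d, (x : EuclideanSpace ℝ (Fin d)) i0 ∂μ +
      ∫ p : Sph d × Sph d, (p.1 : EuclideanSpace ℝ (Fin d)) j * (Lq lam i0 i p.1 p.2 * Kker lam p.1 p.2) ∂μ.prod μ = 0) := by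
  have cL : ∀ i, Continuous (fun p : Sph d × Sph d => Lq lam i0 i p.1 p.2 * Kker lam p.1 p.2) := fun i =>
    (cont_Lq lam i0 i).mul (cont_K lam)
  have cc := cont_coord (d := d)
  have cV : ∀ i, Continuous (fun x : Sph d => ∫ y, Lq lam i0 i x y * Kker lam x y ∂μ) := fun i => cont_int μ (cL i)
  constructor
  · intro i hi
    have h1 := ibp lam i0 i i hi hi 1 0 ε hω μ
    rw [integral_prod _ (ci (cL i) _)]
    rw [gibbs_int lam ω μ ε h]
    have h2 : ∫ x, (∫ y, Lq lam i0 i x y * Kker lam x y ∂μ) * exp (WA lam μ x / ε) ∂ω = ε * 0 := by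
      refine Eq.trans ?_ (congrArg (fun t => ε * t) h1)
      rw [← integral_const_mul]
      congr 1; ext x
      field_simp
      ring
    rw [h2]; simp
  · intro i j hi hj
    have h1 := ibp lam i0 i j hi hj 0 1 ε hω μ
    have cL2 : Continuous (fun p : Sph d × Sph d => (p.1 : EuclideanSpace ℝ (Fin d)) j * (Lq lam i0 i p.1 p.2 * Kker lam p.1 p.2)) := by
      have := cL i
      fun_prop
    rw [integral_prod _ (ci cL2 _)]
    simp_rw [integral_const_mul]
    have cVi := cV i
    rw [← integral_const_mul, ← integral_add (ci (by fun_prop) _) (ci (by fun_prop) _), gibbs_int lam ω μ ε h]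
    have h2 : ∫ x : Sph d, ((if i = j then ε else 0) * (x : EuclideanSpace ℝ (Fin d)) i0 +
        (x : EuclideanSpace ℝ (Fin d)) j * ∫ y, Lq lam i0 i x y * Kker lam x y ∂μ) * exp (WA lam μ x / ε) ∂ω = ε * 0 := by
      refine Eq.trans ?_ (congrArg (fun t => ε * t) h1)
      rw [← integral_const_mul]
      congr 1; ext x
      by_cases hij : i = j
      · rw [if_pos hij, if_pos hij.symm]
        field_simp
        ring
      · rw [if_neg hij, if_neg (Ne.symm hij)]
        field_simp
        ring
    rw [h2]; simp

lemma exp_lip {a b B : ℝ} (ha : a ≤ B) (hb : b ≤ B) : |exp a - exp b| ≤ exp B * |a - b| := by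
  have key : ∀ a b : ℝ, a ≤ B → exp a - exp b ≤ exp B * |a - b| := by
    intro a b ha
    have h1 : exp b = exp a * exp (b - a) := by rw [← exp_add]; congr 1; ring
    have h2 := add_one_le_exp (b - a)
    have h3 : exp a * (b - a + 1) ≤ exp b := by rw [h1]; gcongr
    have h4 : exp a * (a - b) ≤ exp B * |a - b| := (mul_le_mul_of_nonneg_left (le_abs_self _) (exp_pos _).le).trans
      (mul_le_mul_of_nonneg_right (exp_le_exp.2 ha) (abs_nonneg _))
    linarith
  rw [abs_le]
  have := key b a hb
  rw [abs_sub_comm] at this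
  exact ⟨by linarith, key a b ha⟩

lemma sub_pole_le (i0 : Fin d) (y : Sph d) (i : Fin d) :
    |(y : EuclideanSpace ℝ (Fin d)) i - (pole i0 : EuclideanSpace ℝ (Fin d)) i| ≤ rr i0 y := by
  rw [pole_coord]
  by_cases h : i = i0
  · subst h
    have h1 := rr_nonneg i y
    have h2 := rr_le i y
    rw [x0_eq i y, if_pos rfl, abs_le]
    constructor <;> nlinarith
  · rw [if_neg h, sub_zero]; exact coord_le_rr i0 y h

lemma W_lip (lam : Fin d → ℝ) (hpos : ∀ i, 0 < lam i) (i0 : Fin d) (μ : Measure (Sph d)) [IsProbabilityMeasure μ] (x : Sph d) :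
    |WA lam μ x - exp (lam i0 * (1 - rr i0 x ^ 2 / 2))| ≤ exp (∑ i, lam i) * (∑ i, lam i) * √(∫ y, rr i0 y ^ 2 ∂μ) := by
  have hpt : ∀ y, |Kker lam x y - Kker lam x (pole i0)| ≤ exp (∑ i, lam i) * (∑ i, lam i) * rr i0 y := by
    intro y
    have h1 := exp_lip (le_of_abs_le (qA_abs_le lam hpos x y)) (le_of_abs_le (qA_abs_le lam hpos x (pole i0)))
    refine h1.trans ?_
    rw [mul_assoc]
    refine mul_le_mul_of_nonneg_left ?_ (exp_pos _).le
    unfold qA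
    rw [← Finset.sum_sub_distrib, Finset.sum_mul]
    refine (Finset.abs_sum_le_sum_abs _ _).trans (Finset.sum_le_sum fun i _ => ?_)
    rw [← mul_sub, abs_mul, abs_mul, abs_of_pos (hpos i), mul_assoc]
    refine mul_le_mul_of_nonneg_left ?_ (hpos i).le
    have h2 := coord_abs_le x i
    have h3 := sub_pole_le i0 y i
    calc _ ≤ 1 * rr i0 y := mul_le_mul h2 h3 (abs_nonneg _) zero_le_one
      _ = _ := one_mul _
  have h1 : exp (lam i0 * (1 - rr i0 x ^ 2 / 2)) = ∫ y, Kker lam x (pole i0) ∂μ := by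
    rw [← W_pole]; simp [WA]
  have cK := cont_Kx lam x
  have cr := cont_rr i0
  rw [h1]
  unfold WA
  rw [← integral_sub (ci cK _) (integrable_const _)]
  refine abs_integral_le_integral_abs.trans ?_
  refine (integral_mono (ci (by fun_prop) _) (ci (by fun_prop) _) hpt).trans ?_
  rw [integral_const_mul]
  have hL : 0 ≤ ∑ i, lam i := Finset.sum_nonneg fun i _ => (hpos i).le
  refine mul_le_mul_of_nonneg_left ?_ (by positivity)
  exact Real.le_sqrt_of_sq_le (jensen_sq cr μ)

lemma tail (lam : Fin d → ℝ) (hpos : ∀ i, 0 < lam i) (i0 : Fin d) {ω : Measure (Sph d)} (hω : IsUniform ω) (δ : ℝ) (hδ : 0 < δ) :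
    ∃ η > 0, ∃ ε₀ > 0, ∀ ε, 0 < ε → ε < ε₀ → ∀ (μ : Measure (Sph d)) [IsProbabilityMeasure μ], μ = gam lam ω ε μ →
      ∫ x, rr i0 x ^ 2 ∂μ ≤ η → ∫ x, rr i0 x ^ 4 ∂μ ≤ δ * (∫ x, rr i0 x ^ 2 ∂μ) + δ * ε := by
  have := hω.1
  set κ := exp (lam i0 * (1 - δ / 4)) - exp (lam i0 * (1 - δ / 2)) with hκ
  have hκp : 0 < κ := by
    rw [hκ, sub_pos]
    apply exp_lt_exp.2
    apply mul_lt_mul_of_pos_left _ (hpos i0)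
    linarith
  set C := exp (∑ i, lam i) * (∑ i, lam i) with hC
  have hCp : 0 < C := mul_pos (exp_pos _) (Finset.sum_pos (fun i _ => hpos i) ⟨i0, Finset.mem_univ _⟩)
  set c := ω.real (cap i0 (δ / 2)) with hc
  have hcp : 0 < c := cap_pos hω i0 (by linarith)
  refine ⟨(κ / (4 * C)) ^ 2, by positivity, δ * κ ^ 2 * c / 128, by positivity, fun ε hε hε' μ _ hμ hM => ?_⟩
  have hθ : C * √(∫ x, rr i0 x ^ 2 ∂μ) ≤ κ / 4 := by
    have h1 : √(∫ x, rr i0 x ^ 2 ∂μ) ≤ κ / (4 * C) := by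
      rw [Real.sqrt_le_left (by positivity)]; exact hM
    calc _ ≤ C * (κ / (4 * C)) := by gcongr
      _ = κ / 4 := by field_simp
  have hW : ∀ x, |WA lam μ x - exp (lam i0 * (1 - rr i0 x ^ 2 / 2))| ≤ κ / 4 := fun x =>
    (W_lip lam hpos i0 μ x).trans hθ
  have cW := cont_W lam μ
  have cr := cont_rr i0
  have hZ := Z_lower i0 (ω := ω) (f := fun x => WA lam μ x / ε) (by fun_prop) (δ / 2) ((exp (lam i0 * (1 - δ / 4)) - κ / 4) / ε) (by
    intro x hx
    have h1 := (abs_le.1 (hW x)).1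
    have h2 : exp (lam i0 * (1 - δ / 4)) ≤ exp (lam i0 * (1 - rr i0 x ^ 2 / 2)) := by
      apply exp_le_exp.2
      apply mul_le_mul_of_nonneg_left _ (hpos i0).le
      linarith
    have h3 : exp (lam i0 * (1 - δ / 4)) - κ / 4 ≤ WA lam μ x := by linarith
    gcongr)
  rw [← hc] at hZ
  set Z := ∫ x, exp (WA lam μ x / ε) ∂ω with hZdef
  have hZp : 0 < Z := lt_of_lt_of_le (by positivity) hZ
  have hsmall : exp (-(κ / (2 * ε))) ≤ 8 * ε ^ 2 / κ ^ 2 := by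
    have h1 := Real.quadratic_le_exp_of_nonneg (x := κ / (2 * ε)) (by positivity)
    have h2 : (κ / (2 * ε)) ^ 2 / 2 ≤ exp (κ / (2 * ε)) := by
      have : 0 ≤ κ / (2 * ε) := by positivity
      linarith
    rw [exp_neg]
    calc (exp (κ / (2 * ε)))⁻¹ ≤ ((κ / (2 * ε)) ^ 2 / 2)⁻¹ := by gcongr
      _ = _ := by field_simp; norm_num
  have hp : ∀ x, δ < rr i0 x ^ 2 → exp (WA lam μ x / ε) ≤ Z * (8 * ε ^ 2 / (κ ^ 2 * c)) := by
    intro x hx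
    have h1 := (abs_le.1 (hW x)).2
    have h2 : exp (lam i0 * (1 - rr i0 x ^ 2 / 2)) ≤ exp (lam i0 * (1 - δ / 2)) := by
      apply exp_le_exp.2
      apply mul_le_mul_of_nonneg_left _ (hpos i0).le
      linarith
    have h3 : WA lam μ x / ε ≤ (exp (lam i0 * (1 - δ / 4)) - κ / 4) / ε + -(κ / (2 * ε)) := by
      have : -(κ / (2 * ε)) = (-(κ / 2)) / ε := by field_simp
      rw [this, ← add_div]
      gcongr
      linarith
    calc exp (WA lam μ x / ε) ≤ exp ((exp (lam i0 * (1 - δ / 4)) - κ / 4) / ε) * exp (-(κ / (2 * ε))) := by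
          rw [← exp_add]; exact exp_le_exp.2 h3
      _ ≤ (Z / c) * (8 * ε ^ 2 / κ ^ 2) := by
          gcongr
          rw [le_div_iff₀ hcp]; linarith
      _ = _ := by field_simp
  have hpt : ∀ x, rr i0 x ^ 4 * exp (WA lam μ x / ε) ≤ δ * (rr i0 x ^ 2 * exp (WA lam μ x / ε)) + 16 * (Z * (8 * ε ^ 2 / (κ ^ 2 * c))) := by
    intro x
    have hr0 := rr_nonneg i0 x
    have hr2 := rr_le i0 x
    by_cases hx : δ < rr i0 x ^ 2
    · have h1 := hp x hx
      have h2 : rr i0 x ^ 4 ≤ 16 := by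
        calc rr i0 x ^ 4 ≤ 2 ^ 4 := by gcongr
          _ = 16 := by norm_num
      have h3 : rr i0 x ^ 4 * exp (WA lam μ x / ε) ≤ 16 * (Z * (8 * ε ^ 2 / (κ ^ 2 * c))) := by gcongr
      have h4 : 0 ≤ δ * (rr i0 x ^ 2 * exp (WA lam μ x / ε)) := by positivity
      linarith
    · have h1 : rr i0 x ^ 4 ≤ δ * rr i0 x ^ 2 := by
        have : rr i0 x ^ 4 = rr i0 x ^ 2 * rr i0 x ^ 2 := by ring
        rw [this]
        gcongr
        linarith
      have h2 : 0 ≤ 16 * (Z * (8 * ε ^ 2 / (κ ^ 2 * c))) := by positivity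
      have h3 := mul_le_mul_of_nonneg_right h1 (exp_pos (WA lam μ x / ε)).le
      linarith
  have hI := integral_mono (μ := ω) (ci (by fun_prop) ω) (ci (by fun_prop) ω) hpt
  rw [integral_add (ci (by fun_prop) _) (integrable_const _), integral_const_mul] at hI
  simp only [integral_const, probReal_univ, smul_eq_mul, one_mul] at hI
  rw [gibbs_int lam ω μ ε hμ, gibbs_int lam ω μ ε hμ (fun x => rr i0 x ^ 2), ← hZdef]
  have h5 : 16 * (Z * (8 * ε ^ 2 / (κ ^ 2 * c))) ≤ Z * (δ * ε) := by
    have h6 : ε * 128 ≤ δ * κ ^ 2 * c := by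
      have := (lt_div_iff₀ (by norm_num)).1 hε'
      linarith
    have h7 : 128 * ε ^ 2 / (κ ^ 2 * c) ≤ δ * ε := by
      rw [div_le_iff₀ (by positivity)]
      nlinarith
    calc _ = Z * (128 * ε ^ 2 / (κ ^ 2 * c)) := by ring
      _ ≤ _ := by gcongr
  rw [div_le_iff₀ hZp]
  calc _ ≤ _ := hI
    _ ≤ δ * (∫ x, rr i0 x ^ 2 * exp (WA lam μ x / ε) ∂ω) + Z * (δ * ε) := by linarith
    _ = _ := by field_simp


lemma M2_eq (i0 : Fin d) (μ : Measure (Sph d)) [IsProbabilityMeasure μ] :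
    ∫ x, rr i0 x ^ 2 ∂μ = 2 * (1 - ∫ x : Sph d, (x : EuclideanSpace ℝ (Fin d)) i0 ∂μ) := by
  have cc := cont_coord (d := d)
  simp_rw [rr_sq]
  rw [integral_const_mul, integral_sub (integrable_const _) (ci (cc i0) _)]
  simp

set_option maxHeartbeats 1000000 in
lemma good (lam : Fin d → ℝ) (hpos : ∀ i, 0 < lam i) (i0 : Fin d) (l2 : ℝ) (hl20 : 0 ≤ l2) (hl2 : ∀ i, i ≠ i0 → lam i ≤ l2) (hl : l2 < lam i0)
    {ω : Measure (Sph d)} (hω : IsUniform ω) : ∃ Cs > 0, ∀ η > 0, ∃ ε₀ > 0, ∀ ε, 0 < ε → ε < ε₀ → ∀ μ, IsMinimizer lam ω ε μ →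
      (∫ x : Sph d, (x : EuclideanSpace ℝ (Fin d)) i0 ∂μ) ≠ 0 ∧
      (0 < (∫ x : Sph d, (x : EuclideanSpace ℝ (Fin d)) i0 ∂μ) →
        ∫ x, rr i0 x ^ 4 ∂μ ≤ η * ε ∧ ∫ x, rr i0 x ^ 2 ∂μ ≤ Cs * ε ∧
        ∀ i j : Fin d, i ≠ i0 → j ≠ i0 → |lam i0 * exp (lam i0) * (∫ x : Sph d, (x : EuclideanSpace ℝ (Fin d)) i * (x : EuclideanSpace ℝ (Fin d)) j ∂μ)
          - (if i = j then ε else 0)| ≤ η * ε) := by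
  have := hω.1
  obtain ⟨C, hC, HM⟩ := moments lam hpos i0 (fun i hi => (hl2 i hi).trans_lt hl)
  set L := lam i0 * exp (lam i0) with hL
  have hLp : 0 < L := mul_pos (hpos i0) (exp_pos _)
  set D : ℝ := d / L with hD
  have hD0 : 0 ≤ D := by positivity
  refine ⟨2 * D + 4, by positivity, fun η hη => ?_⟩
  set δ := min (1 / (2 * (1 + D * C))) (η / ((1 + C) * (2 * D + 6))) with hδ
  have hδp : 0 < δ := lt_min (by positivity) (by positivity)
  have hδ1 : δ * (2 * (1 + D * C)) ≤ 1 := (le_div_iff₀ (by positivity)).1 (min_le_left _ _)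
  have hδ2 : δ * ((1 + C) * (2 * D + 6)) ≤ η := (le_div_iff₀ (by positivity)).1 (min_le_right _ _)
  obtain ⟨η1, hη1, ε1, hε1, HT⟩ := tail lam hpos i0 hω δ hδp
  set η' := min (1 / 2) (min (η1 / 2) (δ / 2)) with hη'
  have hη'p : 0 < η' := lt_min (by norm_num) (lt_min (by linarith) (by linarith))
  have e1 : η' ≤ 1 / 2 := min_le_left _ _
  have e2 : η' ≤ η1 / 2 := (min_le_right _ _).trans (min_le_left _ _)
  have e3 : η' ≤ δ / 2 := (min_le_right _ _).trans (min_le_right _ _)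
  obtain ⟨ε2, hε2, HC⟩ := conc lam hpos i0 l2 hl20 hl2 hl hω η' hη'p
  refine ⟨min ε1 ε2, lt_min hε1 hε2, fun ε hε hε' μ hμ => ?_⟩
  have := hμ.1
  have hc := HC ε hε (hε'.trans_le (min_le_right _ _)) μ hμ
  obtain ⟨hG, -⟩ := minimizer_props lam hpos ω μ ε hε hμ
  have hM2 := M2_eq i0 μ
  set m := ∫ x : Sph d, (x : EuclideanSpace ℝ (Fin d)) i0 ∂μ with hm
  refine ⟨fun h0 => by rw [h0] at hc; norm_num at hc; linarith, fun hmp => ?_⟩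
  set M2 := ∫ x, rr i0 x ^ 2 ∂μ with hM2def
  set M4 := ∫ x, rr i0 x ^ 4 ∂μ with hM4def
  have hM20 : 0 ≤ M2 := integral_nonneg fun x => by positivity
  have hm1 : m ≤ 1 := by linarith
  have hM2' : M2 ≤ 2 * η' := by nlinarith
  have h4 : M4 ≤ δ * M2 + δ * ε := HT ε hε (hε'.trans_le (min_le_left _ _)) μ hG (by linarith)
  obtain ⟨g1, g2⟩ := gibbs_moments lam i0 hω μ ε hε hG
  have hSig := HM μ ε hε g1 g2
  have hE : C * (M4 + ε * M2) ≤ C * (δ * M2 + 2 * δ * ε) := by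
    refine mul_le_mul_of_nonneg_left ?_ hC.le
    have : ε * M2 ≤ ε * δ := mul_le_mul_of_nonneg_left (by linarith) hε.le
    linarith
  have cc := cont_coord (d := d)
  have cr := cont_rr i0
  have htr : M2 - M4 / 4 = ∑ i ∈ Finset.univ.erase i0, ∫ x : Sph d, (x : EuclideanSpace ℝ (Fin d)) i * (x : EuclideanSpace ℝ (Fin d)) i ∂μ := by
    rw [← integral_finsetSum _ (fun i _ => ci (by fun_prop) _), hM2def, hM4def, ← integral_div, ← integral_sub (ci (by fun_prop) _) (ci (by fun_prop) _)]
    congr 1; ext x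
    rw [← sum_rest]
    exact Finset.sum_congr rfl fun i _ => by ring
  have htr2 : L * (M2 - M4 / 4) ≤ d * (ε + C * (δ * M2 + 2 * δ * ε)) := by
    rw [htr, Finset.mul_sum]
    have h1 : ∀ i ∈ Finset.univ.erase i0, L * (∫ x : Sph d, (x : EuclideanSpace ℝ (Fin d)) i * (x : EuclideanSpace ℝ (Fin d)) i ∂μ) ≤ ε + C * (δ * M2 + 2 * δ * ε) := by
      intro i hi
      have hi' := Finset.ne_of_mem_erase hi
      have := (abs_le.1 (hSig i i hi' hi')).2
      rw [if_pos rfl] at this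
      linarith
    refine (Finset.sum_le_card_nsmul _ _ _ h1).trans ?_
    rw [nsmul_eq_mul]
    refine mul_le_mul_of_nonneg_right ?_ (by positivity)
    have : (Finset.univ.erase i0).card ≤ d := (Finset.card_erase_le).trans (by simp)
    exact_mod_cast this
  have htr3 : M2 - M4 / 4 ≤ D * (ε + C * (δ * M2 + 2 * δ * ε)) := by
    rw [hD, div_mul_eq_mul_div, le_div_iff₀ hLp]; linarith
  have hDCδ : D * C * δ ≤ 1 / 2 := by nlinarith
  have hM2f : M2 ≤ (2 * D + 4) * ε := by
    have a1 : (δ * (1 / 4 + D * C)) * M2 ≤ (1 / 2) * M2 := by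
      refine mul_le_mul_of_nonneg_right ?_ hM20
      nlinarith
    have a2 : (D * C * δ) * ε ≤ 1 / 2 * ε := mul_le_mul_of_nonneg_right hDCδ hε.le
    have a3 : δ * ε ≤ 1 * ε := mul_le_mul_of_nonneg_right (by nlinarith [mul_nonneg hδp.le (mul_nonneg hD0 hC.le)]) hε.le
    linarith
  have hb : δ * M2 ≤ δ * ((2 * D + 4) * ε) := mul_le_mul_of_nonneg_left hM2f hδp.le
  have hx : 0 ≤ δ * ε := by positivity
  have hηε := mul_le_mul_of_nonneg_right hδ2 hε.le
  refine ⟨?_, hM2f, ?_⟩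
  · have : 0 ≤ δ * ε * (C * (2 * D + 6)) := by positivity
    linarith
  · intro i j hi hj
    refine (hSig i j hi hj).trans (hE.trans ?_)
    have h1 : C * (δ * M2 + 2 * δ * ε) ≤ C * (δ * ((2 * D + 4) * ε) + 2 * δ * ε) := by gcongr
    have : 0 ≤ δ * ε * (2 * D + 6) := by positivity
    linarith


lemma phi_nonneg {g : ℝ} (h0 : 0 ≤ g) (h1 : g < 1) : g ^ 2 ≤ (1 + g) * log (1 + g) + (1 - g) * log (1 - g) := by
  have hd : ∀ t ∈ Set.Ico (0:ℝ) 1, HasDerivAt (fun t => (1 + t) * log (1 + t) + (1 - t) * log (1 - t) - t ^ 2)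
      (log (1 + t) - log (1 - t) - 2 * t) t := by
    intro t ht
    have e1 : HasDerivAt (fun t : ℝ => 1 + t) 1 t := (hasDerivAt_id t).const_add 1
    have e2 : HasDerivAt (fun t : ℝ => 1 - t) (-1) t := (hasDerivAt_id t).const_sub 1
    have p1 : (1 + t) ≠ 0 := by have := ht.1; positivity
    have p2 : (1 - t) ≠ 0 := by have := ht.2; exact (sub_pos.2 this).ne'
    have := ((e1.mul (e1.log p1)).add (e2.mul (e2.log p2))).sub (hasDerivAt_pow 2 t)
    refine this.congr_deriv ?_
    field_simp
    ring
  have hm : MonotoneOn (fun t => (1 + t) * log (1 + t) + (1 - t) * log (1 - t) - t ^ 2) (Set.Ico (0:ℝ) 1) := by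
    refine monotoneOn_of_deriv_nonneg (convex_Ico 0 1) (fun t ht => (hd t ht).continuousAt.continuousWithinAt)
      (fun t ht => (hd t (interior_subset ht)).differentiableAt.differentiableWithinAt) ?_
    intro t ht
    have ht' := interior_subset ht
    rw [(hd t ht').deriv]
    have q : 0 < 1 - t := sub_pos.2 ht'.2
    have p : 0 < 1 + t := by have := ht'.1; linarith
    have h := Real.le_log_one_add_of_nonneg (x := 2 * t / (1 - t)) (div_nonneg (by linarith [ht'.1]) q.le)
    have e1 : 1 + 2 * t / (1 - t) = (1 + t) / (1 - t) := by field_simp; ring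
    have e2 : 2 * (2 * t / (1 - t)) / (2 * t / (1 - t) + 2) = 2 * t := by field_simp; ring
    rw [e1, e2, log_div p.ne' q.ne'] at h
    linarith
  have := hm (Set.left_mem_Ico.2 one_pos) ⟨h0, h1⟩ h0
  simp at this
  linarith

lemma phi_nonneg' {g : ℝ} (h0 : -1 < g) (h1 : g < 1) : g ^ 2 ≤ (1 + g) * log (1 + g) + (1 - g) * log (1 - g) := by
  rcases le_total 0 g with h | h
  · exact phi_nonneg h h1
  · have := phi_nonneg (g := -g) (by linarith) (by linarith)
    rw [neg_sq, ← sub_eq_add_neg, sub_neg_eq_add] at this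
    linarith

lemma ent_pt (a b : ℝ) : (exp a + exp b) / 2 * ((exp a - exp b) / (exp a + exp b)) ^ 2
    ≤ a * exp a + b * exp b - 2 * ((exp a + exp b) / 2 * log ((exp a + exp b) / 2)) := by
  have hP := exp_pos a
  have hQ := exp_pos b
  set P := exp a with hPd
  set Q := exp b with hQd
  set r := (P + Q) / 2 with hr
  set g := (P - Q) / (P + Q) with hg
  have hrp : 0 < r := by positivity
  have e1 : P = r * (1 + g) := by rw [hr, hg]; field_simp; ring
  have e2 : Q = r * (1 - g) := by rw [hr, hg]; field_simp; ring
  have g1 : 0 < 1 + g := by by_contra hh; rw [not_lt] at hh; nlinarith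
  have g2 : 0 < 1 - g := by by_contra hh; rw [not_lt] at hh; nlinarith
  have la : a = log r + log (1 + g) := by rw [← log_mul hrp.ne' g1.ne', ← e1, hPd, log_exp]
  have lb : b = log r + log (1 - g) := by rw [← log_mul hrp.ne' g2.ne', ← e2, hQd, log_exp]
  have key := phi_nonneg' (g := g) (by linarith) (by linarith)
  have k2 := mul_le_mul_of_nonneg_left key hrp.le
  rw [la, lb, e1, e2]
  linarith

lemma IA_dens (lam : Fin d → ℝ) (μ ρ : Measure (Sph d)) [IsProbabilityMeasure μ] [IsProbabilityMeasure ρ] {w : Sph d → ℝ} (hw : Continuous w)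
    (h : ∀ f : Sph d → ℝ, Continuous f → ∫ x, f x ∂μ = ∫ x, f x * w x ∂ρ) :
    IA lam μ = ∫ p, Kker lam p.1 p.2 * (w p.1 * w p.2) ∂(ρ.prod ρ) := by
  have cK := cont_K lam
  rw [integral_prod _ (ci (by fun_prop) _)]
  change ∫ x, WA lam μ x ∂μ = _
  rw [h _ (cont_W lam μ)]
  congr 1; ext x
  unfold WA
  rw [h _ (cont_Kx lam x), ← integral_mul_const]
  congr 1; ext y
  ring

lemma IA_par (lam : Fin d → ℝ) (μ ν ρ : Measure (Sph d)) [IsProbabilityMeasure μ] [IsProbabilityMeasure ν] [IsProbabilityMeasure ρ] {g : Sph d → ℝ} (hg : Continuous g)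
    (h : ∀ f : Sph d → ℝ, Continuous f → ∫ x, f x ∂μ = ∫ x, f x * (1 + g x) ∂ρ)
    (h' : ∀ f : Sph d → ℝ, Continuous f → ∫ x, f x ∂ν = ∫ x, f x * (1 - g x) ∂ρ) :
    IA lam μ + IA lam ν = 2 * IA lam ρ + 2 * ∫ p, Kker lam p.1 p.2 * (g p.1 * g p.2) ∂(ρ.prod ρ) := by
  have cK := cont_K lam
  rw [IA_dens lam μ ρ (by fun_prop) h, IA_dens lam ν ρ (by fun_prop) h',
    IA_dens lam ρ ρ (w := fun _ => 1) (by fun_prop) (by simp), ← mul_add,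
    ← integral_add (ci (by fun_prop) _) (ci (by fun_prop) _), ← integral_add (ci (by fun_prop) _) (ci (by fun_prop) _), ← integral_const_mul]
  congr 1; ext p
  ring

/-- abstract comparison step -/
lemma compare (lam : Fin d → ℝ) (hpos : ∀ i, 0 < lam i) {ω : Measure (Sph d)} (hω : IsUniform ω) (ε : ℝ) (hε : 0 < ε)
    (μ ν : Measure (Sph d)) (hμ : IsMinimizer lam ω ε μ) (hν : IsMinimizer lam ω ε ν) :
    ∃ (ρ : Measure (Sph d)) (g : Sph d → ℝ), IsProbabilityMeasure ρ ∧ Continuous g ∧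
      (∀ f : Sph d → ℝ, Continuous f → ∫ x, f x ∂μ = ∫ x, f x * (1 + g x) ∂ρ) ∧
      (∀ f : Sph d → ℝ, Continuous f → ∫ x, f x ∂ν = ∫ x, f x * (1 - g x) ∂ρ) ∧
      ε * ∫ x, g x ^ 2 ∂ρ ≤ ∫ p, Kker lam p.1 p.2 * (g p.1 * g p.2) ∂(ρ.prod ρ) := by
  have := hω.1
  have dens : ∀ μ, IsMinimizer lam ω ε μ → ∃ a : Sph d → ℝ, Continuous a ∧ (∀ f : Sph d → ℝ, ∫ x, f x ∂μ = ∫ x, f x * exp (a x) ∂ω) ∧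
      EA lam ω ε μ = ((ε * (∫ x, a x ∂μ) - IA lam μ / 2 : ℝ) : EReal) := by
    intro μ hμ
    have := hμ.1
    obtain ⟨h1, -⟩ := minimizer_props lam hpos ω μ ε hε hμ
    have cW := cont_W lam μ
    have cf : Continuous (fun x => WA lam μ x / ε) := by fun_prop
    have hZ : 0 < ∫ x, exp (WA lam μ x / ε) ∂ω := integral_exp_pos (ci (by fun_prop) ω)
    refine ⟨fun x => WA lam μ x / ε - log (∫ x, exp (WA lam μ x / ε) ∂ω), by fun_prop, ?_, ?_⟩
    · intro f
      rw [gibbs_int lam ω μ ε h1, ← integral_div]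
      congr 1; ext x
      rw [exp_sub, exp_log hZ]; ring
    · have h2 := EA_tilted lam ω ε cf
      have h4 : (ω.tilted fun x => WA lam μ x / ε) = μ := h1.symm
      rw [h4] at h2
      rw [h2, integral_sub (ci cf _) (integrable_const _)]
      simp
  obtain ⟨a, ca, ha, hEa⟩ := dens μ hμ
  obtain ⟨b, cb, hb, hEb⟩ := dens ν hν
  have := hμ.1
  have := hν.1
  set r : Sph d → ℝ := fun x => (exp (a x) + exp (b x)) / 2 with hr
  have hrp : ∀ x, 0 < r x := fun x => by simp only [hr]; positivity
  have cr : Continuous r := by fun_prop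
  have cl : Continuous (fun x => log (r x)) := cr.log fun x => (hrp x).ne'
  set ρ := ω.tilted (fun x => log (r x)) with hρ
  have hρp : IsProbabilityMeasure ρ := tilted_prob ω cl
  have i1 : ∫ x, exp (a x) ∂ω = 1 := by have := ha (fun _ => 1); simpa using this.symm
  have i2 : ∫ x, exp (b x) ∂ω = 1 := by have := hb (fun _ => 1); simpa using this.symm
  have hr1 : ∫ x, exp (log (r x)) ∂ω = 1 := by
    simp_rw [exp_log (hrp _)]
    simp only [hr]
    rw [integral_div, integral_add (ci (by fun_prop) _) (ci (by fun_prop) _), i1, i2]; norm_num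
  have hρi : ∀ f : Sph d → ℝ, ∫ x, f x ∂ρ = ∫ x, f x * r x ∂ω := by
    intro f
    rw [hρ, integral_tilted, hr1]
    congr 1; ext x
    rw [exp_log (hrp x), smul_eq_mul]; ring
  set g : Sph d → ℝ := fun x => (exp (a x) - exp (b x)) / (exp (a x) + exp (b x)) with hg
  have cg : Continuous g := by
    have : ∀ x, exp (a x) + exp (b x) ≠ 0 := fun x => by positivity
    simp only [hg]
    exact (by fun_prop : Continuous fun x => exp (a x) - exp (b x)).div (by fun_prop) this
  have hA : ∀ f : Sph d → ℝ, Continuous f → ∫ x, f x ∂μ = ∫ x, f x * (1 + g x) ∂ρ := by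
    intro f _
    rw [ha, hρi]
    congr 1; ext x
    have : exp (a x) + exp (b x) ≠ 0 := by positivity
    simp only [hg, hr]; field_simp; ring
  have hB : ∀ f : Sph d → ℝ, Continuous f → ∫ x, f x ∂ν = ∫ x, f x * (1 - g x) ∂ρ := by
    intro f _
    rw [hb, hρi]
    congr 1; ext x
    have : exp (a x) + exp (b x) ≠ 0 := by positivity
    simp only [hg, hr]; field_simp; ring
  refine ⟨ρ, g, hρp, cg, hA, hB, ?_⟩
  have hEr := EA_tilted lam ω ε cl
  rw [hr1, log_one, sub_zero, ← hρ] at hEr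
  have m1 := hμ.2 ρ hρp
  have m2 := hν.2 ρ hρp
  rw [hEa, hEr, EReal.coe_le_coe_iff] at m1
  rw [hEb, hEr, EReal.coe_le_coe_iff] at m2
  have hpar := IA_par lam μ ν ρ cg hA hB
  have hent : ∫ x, g x ^ 2 ∂ρ ≤ (∫ x, a x ∂μ) + (∫ x, b x ∂ν) - 2 * ∫ x, log (r x) ∂ρ := by
    rw [ha, hb, hρi, hρi, ← integral_const_mul, ← integral_add (ci (by fun_prop) _) (ci (by fun_prop) _), ← integral_sub (ci (by fun_prop) _) (ci (by fun_prop) _)]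
    refine integral_mono (ci (by fun_prop) _) (ci (by fun_prop) _) fun x => ?_
    have := ent_pt (a x) (b x)
    simp only [hg, hr]
    linarith
  have := mul_le_mul_of_nonneg_left hent hε.le
  linarith

lemma unique_pos (lam : Fin d → ℝ) (hpos : ∀ i, 0 < lam i) (i0 : Fin d) (l2 : ℝ) (hl20 : 0 ≤ l2) (hl2 : ∀ i, i ≠ i0 → lam i ≤ l2) (hl : l2 < lam i0)
    {ω : Measure (Sph d)} (hω : IsUniform ω) : ∃ ε₀ > 0, ∀ ε, 0 < ε → ε < ε₀ → 
      (∀ μ, IsMinimizer lam ω ε μ → (∫ x : Sph d, (x : EuclideanSpace ℝ (Fin d)) i0 ∂μ) ≠ 0) ∧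
      (∀ μ ν, IsMinimizer lam ω ε μ → IsMinimizer lam ω ε ν → 0 < (∫ x : Sph d, (x : EuclideanSpace ℝ (Fin d)) i0 ∂μ) →
        0 < (∫ x : Sph d, (x : EuclideanSpace ℝ (Fin d)) i0 ∂ν) → μ = ν) := by
  obtain ⟨C, hC, HS⟩ := spectral lam hpos i0 l2 hl20 hl2
  obtain ⟨Cs, hCs, HG⟩ := good lam hpos i0 l2 hl20 hl2 hl hω
  set L := lam i0 * exp (lam i0) with hL
  have hl0 := hpos i0
  have hLp : 0 < L := mul_pos hl0 (exp_pos _)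
  set θ := 1 - l2 / lam i0 with hθ
  have hθp : 0 < θ := by rw [hθ, sub_pos, div_lt_one hl0]; exact hl
  set t := min 1 (θ / (2 * (d + C * √Cs + 1))) with ht
  have htp : 0 < t := lt_min one_pos (by positivity)
  have ht1 : t ≤ 1 := min_le_left _ _
  have ht2 : t * (2 * (d + C * √Cs + 1)) ≤ θ := (le_div_iff₀ (by positivity)).1 (min_le_right _ _)
  obtain ⟨ε₀, hε₀, H⟩ := HG (t ^ 2) (by positivity)
  refine ⟨ε₀, hε₀, fun ε hε hε' => ⟨fun μ hμ => (H ε hε hε' μ hμ).1, fun μ ν hμ hν hmμ hmν => ?_⟩⟩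
  obtain ⟨p4, p2, pS⟩ := (H ε hε hε' μ hμ).2 hmμ
  obtain ⟨q4, q2, qS⟩ := (H ε hε hε' ν hν).2 hmν
  obtain ⟨ρ, g, hρ, cg, hA, hB, hcmp⟩ := compare lam hpos hω ε hε μ ν hμ hν
  have := hμ.1
  have := hν.1
  have cr := cont_rr i0
  have cc := cont_coord (d := d)
  have avg : ∀ f : Sph d → ℝ, Continuous f → ∫ x, f x ∂ρ = ((∫ x, f x ∂μ) + ∫ x, f x ∂ν) / 2 := by
    intro f cf
    rw [hA f cf, hB f cf, ← integral_add (ci (by fun_prop) _) (ci (by fun_prop) _), ← integral_div]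
    congr 1; ext x; ring
  have hg0 : ∫ x, g x ∂ρ = 0 := by
    have h1 := hA (fun _ => 1) continuous_const
    simp only [one_mul] at h1
    rw [integral_add (integrable_const _) (ci cg _)] at h1
    simp at h1
    exact h1
  have r4 : ∫ x, rr i0 x ^ 4 ∂ρ ≤ t ^ 2 * ε := by rw [avg _ (by fun_prop)]; linarith
  have r2 : ∫ x, rr i0 x ^ 2 ∂ρ ≤ Cs * ε := by rw [avg _ (by fun_prop)]; linarith
  have rS : ∀ i j : Fin d, i ≠ i0 → j ≠ i0 → |(∫ x : Sph d, (x : EuclideanSpace ℝ (Fin d)) i * (x : EuclideanSpace ℝ (Fin d)) j ∂ρ)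
      - (if i = j then ε / L else 0)| ≤ t ^ 2 * ε / L := by
    intro i j hi hj
    have h1 := abs_le.1 (pS i j hi hj)
    have h2 := abs_le.1 (qS i j hi hj)
    rw [avg _ (by fun_prop)]
    have e : (if i = j then ε / L else 0) = (if i = j then ε else 0) / L := by split_ifs <;> simp
    rw [e, le_div_iff₀ hLp, ← abs_of_pos hLp, ← abs_mul, abs_of_pos hLp, sub_mul, div_mul_cancel₀ _ hLp.ne', abs_le]
    constructor <;> linarith
  have hS := HS ρ g (ε / L) (t ^ 2 * ε / L) cg hg0 (by positivity) (by positivity) rS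
  have hsq : √(∫ x, rr i0 x ^ 4 ∂ρ) * √(∫ x, rr i0 x ^ 2 ∂ρ) ≤ t * √Cs * ε := by
    have h1 : √(∫ x, rr i0 x ^ 4 ∂ρ) ≤ t * √ε := by
      rw [Real.sqrt_le_left (by positivity), mul_pow, Real.sq_sqrt hε.le]; exact r4
    have h2 : √(∫ x, rr i0 x ^ 2 ∂ρ) ≤ √Cs * √ε := by
      rw [Real.sqrt_le_left (by positivity), mul_pow, Real.sq_sqrt hε.le, Real.sq_sqrt hCs.le]; exact r2
    calc _ ≤ (t * √ε) * (√Cs * √ε) := by gcongr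
      _ = t * √Cs * (√ε * √ε) := by ring
      _ = _ := by rw [Real.mul_self_sqrt hε.le]
  have hG0 : 0 ≤ ∫ x, g x ^ 2 ∂ρ := integral_nonneg fun x => sq_nonneg _
  have hcoef : exp (lam i0) * (l2 * (ε / L + d * (t ^ 2 * ε / L))) + C * (√(∫ x, rr i0 x ^ 4 ∂ρ) * √(∫ x, rr i0 x ^ 2 ∂ρ)) ≤ (1 - θ / 2) * ε := by
    have e1 : exp (lam i0) * (l2 * (ε / L + d * (t ^ 2 * ε / L))) = ((1 - θ) * (1 + d * t ^ 2)) * ε := by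
      rw [hθ, hL]; field_simp; ring
    have e2 : (1 - θ) * (1 + d * t ^ 2) ≤ (1 - θ) + d * t := by
      have a1 : (1 - θ) * (d * t ^ 2) ≤ 1 * (d * t) := by
        have : t ^ 2 ≤ t := by nlinarith
        have d0 : (0:ℝ) ≤ d := Nat.cast_nonneg d
        refine mul_le_mul (by linarith) (by gcongr) (by positivity) zero_le_one
      linarith
    have e3 := mul_le_mul_of_nonneg_right e2 hε.le
    have e4 := mul_le_mul_of_nonneg_left hsq hC.le
    have e5 := mul_le_mul_of_nonneg_right ht2 hε.le
    have e6 : 0 ≤ t * ε := by positivity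
    rw [e1]
    linarith
  have hfin : ∫ x, g x ^ 2 ∂ρ = 0 := by
    have h1 := mul_le_mul_of_nonneg_right hcoef hG0
    have h2 : ε * (∫ x, g x ^ 2 ∂ρ) ≤ ((1 - θ / 2) * ε) * ∫ x, g x ^ 2 ∂ρ := hcmp.trans (hS.trans h1)
    have h3 : (θ / 2 * ε) * ∫ x, g x ^ 2 ∂ρ ≤ 0 := by linarith
    have h4 : 0 < θ / 2 * ε := by positivity
    refine le_antisymm ?_ hG0
    by_contra hh
    rw [not_le] at hh
    exact absurd h3 (not_le.2 (mul_pos h4 hh))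
  refine ext_of_forall_integral_eq_of_IsFiniteMeasure fun f => ?_
  have cf : Continuous (fun x => f x) := f.continuous
  have h1 := cs_cont cf cg ρ
  rw [hfin, mul_zero] at h1
  have h2 : ∫ x, f x * g x ∂ρ = 0 := by nlinarith [sq_nonneg (∫ x, f x * g x ∂ρ)]
  rw [hA _ cf, hB _ cf]
  simp_rw [mul_add, mul_sub, mul_one]
  rw [integral_add (ci (by fun_prop) _) (ci (by fun_prop) _), integral_sub (ci (by fun_prop) _) (ci (by fun_prop) _), h2]
  simp

/-- for all small `ε`, the set of global minimizers of `E_{ε,A}`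
consists of exactly two distinct measures which are antipodal images of each other. -/
theorem stmt0 (d : ℕ) (hd : 2 ≤ d) (lam : Fin d → ℝ)
    (hanti : Antitone lam)
    (hgap : lam ⟨1, by omega⟩ < lam ⟨0, by omega⟩)
    (hpos : ∀ i, 0 < lam i)
    (ω : Measure (Sph d)) (hω : IsUniform ω) :
    ∃ ε₀ : ℝ, 0 < ε₀ ∧ ∀ ε : ℝ, 0 < ε → ε < ε₀ →
      ∃ μp μm : Measure (Sph d), μp ≠ μm ∧ μm = Measure.map antip μp ∧
        {μ : Measure (Sph d) | IsMinimizer lam ω ε μ} = {μp, μm} := by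
  have hω1 := hω.1
  have hmap : ∀ ν : Measure (Sph d), Measure.map antip (Measure.map antip ν) = ν := by
    intro ν
    rw [Measure.map_map cont_antip.measurable cont_antip.measurable]
    have : (antip ∘ antip : Sph d → Sph d) = id := funext antip_antip
    rw [this, Measure.map_id]
  have hflip : ∀ ν : Measure (Sph d),
      ∫ x : Sph d, (x : EuclideanSpace ℝ (Fin d)) ⟨0, by omega⟩ ∂(Measure.map antip ν) =
        -∫ x : Sph d, (x : EuclideanSpace ℝ (Fin d)) ⟨0, by omega⟩ ∂ν := by
    intro ν
    rw [int_antip ν (cont_coord _)]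
    simp_rw [antip_coord]
    exact integral_neg _
  obtain ⟨ε₀, hε₀, H⟩ := unique_pos lam hpos ⟨0, by omega⟩ (lam ⟨1, by omega⟩) (hpos _).le
    (fun i hi => hanti (by
      rw [Fin.le_def]
      have h0 : i.val ≠ 0 := fun h => hi (Fin.ext h)
      show 1 ≤ i.val
      omega)) hgap hω
  refine ⟨ε₀, hε₀, fun ε hε hlt => ?_⟩
  obtain ⟨hne, huniq⟩ := H ε hε hlt
  obtain ⟨μ, hμ, hμpos⟩ : ∃ μ : Measure (Sph d), IsMinimizer lam ω ε μ ∧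
      0 < ∫ x : Sph d, (x : EuclideanSpace ℝ (Fin d)) ⟨0, by omega⟩ ∂μ := by
    obtain ⟨μ, hμ⟩ := exists_minimizer lam hpos ω ε hε
    rcases lt_or_gt_of_ne (hne μ hμ) with h | h
    · exact ⟨_, minimizer_antip lam hpos hω μ ε hε hμ, by rw [hflip]; linarith⟩
    · exact ⟨μ, hμ, h⟩
  refine ⟨μ, Measure.map antip μ, ?_, rfl, ?_⟩
  · intro h
    have h1 := hflip μ
    rw [← h] at h1
    linarith
  · ext ν
    simp only [Set.mem_ofPred_eq, Set.mem_insert_iff, Set.mem_singleton_iff]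
    constructor
    · intro hν
      rcases lt_or_gt_of_ne (hne ν hν) with h | h
      · right
        have h2 := huniq (Measure.map antip ν) μ (minimizer_antip lam hpos hω ν ε hε hν) hμ
          (by rw [hflip]; linarith) hμpos
        rw [← h2, hmap]
      · left
        exact huniq ν μ hν hμ h hμpos
    · rintro (rfl | rfl)
      · exact hμ
      · exact minimizer_antip lam hpos hω μ ε hε hμ

end
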